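/- Let (X_i)_{i≥0} be a centered stationary Gaussian sequence with E[X_i²] = 1 and covariance Cov(X_i,X_j) = φ(|i−j|), where φ : ℕ → ℝ is non-increasing and φ(1) < 1/2. Then there exist α = α(φ) ∈ (0,1) and a constant C = C(φ) > 0 such that for all n ≥ 2, Var(M_n) ≤ C · max(φ(⌊n^α⌋), 1/log n), where M_n = max_{1≤i≤n} X_i. -/

import Mathlib

open MeasureTheory ProbabilityTheory Real

section PGsec
variable {E : Type*} [NormedAddCommGroup E] [NormedSpace ℝ E] [MeasurableSpace E] [BorelSpace E]
  [SecondCountableTopology E] [CompleteSpace E]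
variable {F : Type*} [NormedAddCommGroup F] [NormedSpace ℝ F] [MeasurableSpace F] [BorelSpace F]
  [SecondCountableTopology F] [CompleteSpace F]

/-- Measurable functions of polynomial growth. -/
def PG {E : Type*} [NormedAddCommGroup E] [MeasurableSpace E] (u : E → ℝ) : Prop :=
  Measurable u ∧ ∃ A : ℝ, 0 ≤ A ∧ ∃ k : ℕ, ∀ z, |u z| ≤ A * (1 + ‖z‖) ^ k

omit [NormedSpace ℝ E] [BorelSpace E] [SecondCountableTopology E] [CompleteSpace E] in
lemma PG.const (a : ℝ) : PG (fun _ : E => a) :=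
  ⟨measurable_const, |a|, abs_nonneg _, 0, fun z => by simp⟩

omit [NormedSpace ℝ E] [BorelSpace E] [SecondCountableTopology E] [CompleteSpace E] in
lemma PG.add {u v : E → ℝ} (hu : PG u) (hv : PG v) : PG (fun x => u x + v x) := by
  obtain ⟨mu, A, hA, k, h⟩ := hu
  obtain ⟨mv, B, hB, l, h'⟩ := hv
  refine ⟨mu.add mv, A + B, by positivity, k + l, fun z => ?_⟩
  have h1 : (1:ℝ) ≤ 1 + ‖z‖ := by linarith [norm_nonneg z]
  have h2 : (1 + ‖z‖) ^ k ≤ (1 + ‖z‖) ^ (k + l) := pow_le_pow_right₀ h1 (by omega)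
  have h3 : (1 + ‖z‖) ^ l ≤ (1 + ‖z‖) ^ (k + l) := pow_le_pow_right₀ h1 (by omega)
  calc |u z + v z| ≤ |u z| + |v z| := abs_add_le _ _
    _ ≤ A * (1 + ‖z‖) ^ k + B * (1 + ‖z‖) ^ l := add_le_add (h z) (h' z)
    _ ≤ A * (1 + ‖z‖) ^ (k + l) + B * (1 + ‖z‖) ^ (k + l) := by gcongr
    _ = _ := by ring

omit [NormedSpace ℝ E] [BorelSpace E] [SecondCountableTopology E] [CompleteSpace E] in
lemma PG.mul {u v : E → ℝ} (hu : PG u) (hv : PG v) : PG (fun x => u x * v x) := by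
  obtain ⟨mu, A, hA, k, h⟩ := hu
  obtain ⟨mv, B, hB, l, h'⟩ := hv
  refine ⟨mu.mul mv, A * B, by positivity, k + l, fun z => ?_⟩
  rw [abs_mul]
  calc |u z| * |v z| ≤ (A * (1 + ‖z‖) ^ k) * (B * (1 + ‖z‖) ^ l) :=
        mul_le_mul (h z) (h' z) (abs_nonneg _) (by positivity)
    _ = _ := by ring

omit [NormedSpace ℝ E] [BorelSpace E] [SecondCountableTopology E] [CompleteSpace E] in
lemma PG.cmul {u : E → ℝ} (a : ℝ) (hu : PG u) : PG (fun x => a * u x) :=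
  (PG.const a).mul hu

omit [NormedSpace ℝ E] [BorelSpace E] [SecondCountableTopology E] [CompleteSpace E] in
lemma PG.sub {u v : E → ℝ} (hu : PG u) (hv : PG v) : PG (fun x => u x - v x) := by
  have := hu.add (hv.cmul (-1))
  simpa [sub_eq_add_neg] using this

omit [NormedSpace ℝ E] [BorelSpace E] [SecondCountableTopology E] [CompleteSpace E] in
lemma PG.sq {u : E → ℝ} (hu : PG u) : PG (fun x => u x ^ 2) := by
  simpa [_root_.sq] using hu.mul hu

omit [NormedSpace ℝ E] [BorelSpace E] [SecondCountableTopology E] [CompleteSpace E] in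
lemma PG.sum {κ : Type*} (s : Finset κ) {u : κ → E → ℝ} (hu : ∀ i ∈ s, PG (u i)) :
    PG (fun x => ∑ i ∈ s, u i x) := by
  classical
  induction s using Finset.induction_on with
  | empty => simpa using PG.const (E := E) 0
  | insert a s ha ih =>
    simp only [Finset.sum_insert ha]
    exact (hu a (by simp)).add (ih fun i hi => hu i (by simp [hi]))

omit [SecondCountableTopology E] [CompleteSpace E] [SecondCountableTopology F] [CompleteSpace F] in
lemma PG.comp_clm {u : F → ℝ} (hu : PG u) (L : E →L[ℝ] F) : PG (fun x => u (L x)) := by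
  obtain ⟨mu, A, hA, k, h⟩ := hu
  refine ⟨mu.comp L.continuous.measurable, A * (1 + ‖L‖) ^ k, by positivity, k, fun z => ?_⟩
  calc |u (L z)| ≤ A * (1 + ‖L z‖) ^ k := h _
    _ ≤ A * ((1 + ‖L‖) * (1 + ‖z‖)) ^ k := by
        gcongr
        nlinarith [L.le_opNorm z, norm_nonneg z, norm_nonneg L]
    _ = _ := by rw [mul_pow]; ring

omit [SecondCountableTopology E] [CompleteSpace E] in
lemma PG.clm (L : E →L[ℝ] ℝ) : PG (fun x => L x) := by
  refine ⟨L.continuous.measurable, ‖L‖, norm_nonneg _, 1, fun z => ?_⟩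
  have := L.le_opNorm z
  rw [Real.norm_eq_abs] at this
  nlinarith [norm_nonneg z, norm_nonneg L]

lemma integrable_growth (μ : Measure E) [IsGaussian μ] (k : ℕ) :
    Integrable (fun z : E => (1 + ‖z‖) ^ k) μ := by
  have h1 : MemLp (fun z : E => 1 + ‖z‖) k μ :=
by
    have a1 : MemLp (fun _ : E => (1:ℝ)) k μ := memLp_const 1
    have a2 : MemLp (fun z : E => ‖z‖) k μ :=
      (IsGaussian.memLp_id μ (k : ENNReal) (ENNReal.natCast_ne_top k)).norm
    exact a1.add a2
  have h2 := h1.integrable_norm_pow'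
  refine h2.congr (Filter.Eventually.of_forall fun z => ?_)
  simp only
  rw [Real.norm_eq_abs, abs_of_nonneg (by positivity)]

lemma PG.integrable {u : E → ℝ} (hu : PG u) (μ : Measure E) [IsGaussian μ] :
    Integrable u μ := by
  obtain ⟨mu, A, hA, k, h⟩ := hu
  refine ((integrable_growth μ k).const_mul A).mono' mu.aestronglyMeasurable
    (Filter.Eventually.of_forall fun z => ?_)
  rw [Real.norm_eq_abs]; exact h z

omit [BorelSpace E] [SecondCountableTopology E] [CompleteSpace E]
  [BorelSpace F] [SecondCountableTopology F] [CompleteSpace F] in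
omit [NormedSpace ℝ E] [NormedSpace ℝ F] in
lemma PG.fst {u : E → ℝ} (hu : PG u) : PG (fun z : E × F => u z.1) := by
  obtain ⟨mu, A, hA, k, h⟩ := hu
  refine ⟨mu.comp measurable_fst, A, hA, k, fun z => (h z.1).trans ?_⟩
  gcongr
  exact norm_fst_le z

/-- linear combination as a continuous linear map on the product -/
def lc (c s : ℝ) : E × E →L[ℝ] E :=
  c • ContinuousLinearMap.fst ℝ E E + s • ContinuousLinearMap.snd ℝ E E

omit [MeasurableSpace E] [BorelSpace E] [SecondCountableTopology E] [CompleteSpace E] in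
lemma lc_apply (c s : ℝ) (z : E × E) : lc c s z = c • z.1 + s • z.2 := rfl

omit [CompleteSpace E] in
lemma PG.lc {u : E → ℝ} (hu : PG u) (c s : ℝ) : PG (fun z : E × E => u (c • z.1 + s • z.2)) :=
  hu.comp_clm (_root_.lc c s)

/-- The Mehler (noise) operator. -/
noncomputable def T (γ : Measure E) (c s : ℝ) (u : E → ℝ) : E → ℝ :=
  fun x => ∫ y, u (c • x + s • y) ∂γ

variable (γ : Measure E) [IsGaussian γ]

lemma PG.slice {u : E → ℝ} (hu : PG u) (c s : ℝ) (x : E) :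
    Integrable (fun y => u (c • x + s • y)) γ := by
  obtain ⟨mu, A, hA, k, h⟩ := hu
  have hm : Measurable (fun y : E => c • x + s • y) := by fun_prop
  refine Integrable.mono' ((integrable_growth γ k).const_mul (A * ((1 + |c| * ‖x‖) * (1 + |s|)) ^ k))
    (mu.comp hm).aestronglyMeasurable
    (Filter.Eventually.of_forall fun y => ?_)
  rw [Real.norm_eq_abs]
  refine (h _).trans ?_
  rw [mul_assoc, ← mul_pow]
  gcongr
  have := norm_add_le (c • x) (s • y)
  rw [norm_smul, norm_smul, Real.norm_eq_abs, Real.norm_eq_abs] at this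
  have h1 : 0 ≤ |c| * ‖x‖ := by positivity
  have h2 : 0 ≤ |s| * ‖y‖ := by positivity
  have h3 := norm_nonneg y
  have h4 := abs_nonneg s
  nlinarith [mul_nonneg h1 h2, mul_nonneg h1 h3, mul_nonneg h1 h4]

lemma PG.T {u : E → ℝ} (hu : PG u) (c s : ℝ) : PG (T γ c s u) := by
  have hs := hu.slice γ c s
  obtain ⟨mu, A, hA, k, h⟩ := hu
  refine ⟨?_, A * ∫ y, ((1 + |c|) * (1 + |s|) * (1 + ‖y‖)) ^ k ∂γ, ?_, k, fun x => ?_⟩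
  · have : StronglyMeasurable (fun z : E × E => u (c • z.1 + s • z.2)) :=
      (mu.comp (_root_.lc c s).continuous.measurable).stronglyMeasurable
    exact this.integral_prod_right.measurable
  · exact mul_nonneg hA (integral_nonneg fun y => by positivity)
  · have hi : Integrable (fun y : E => A * ((1 + |c|) * (1 + |s|) * (1 + ‖y‖)) ^ k) γ := by
      simp_rw [mul_pow]
      exact ((integrable_growth γ k).const_mul _).const_mul _
    calc |_root_.T γ c s u x| ≤ ∫ y, |u (c • x + s • y)| ∂γ := abs_integral_le_integral_abs
      _ ≤ ∫ y, A * ((1 + |c|) * (1 + |s|) * (1 + ‖y‖)) ^ k * (1 + ‖x‖) ^ k ∂γ := by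
          refine integral_mono (hs x).abs (hi.mul_const _) fun y => ?_
          refine (h _).trans ?_
          rw [mul_assoc, ← mul_pow]
          gcongr
          have := norm_add_le (c • x) (s • y)
          rw [norm_smul, norm_smul, Real.norm_eq_abs, Real.norm_eq_abs] at this
          have h1 := norm_nonneg x
          have h2 := norm_nonneg y
          have h3 := abs_nonneg s
          have h4 := abs_nonneg c
          have h5 : (1 + |c|) * (1 + |s|) * (1 + ‖y‖) * (1 + ‖x‖) =
            1 + |c| * ‖x‖ + |s| * ‖y‖ + (|c| + ‖x‖ + |s| + ‖y‖ + |c| * |s| + |c| * ‖y‖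
              + |s| * ‖x‖ + ‖x‖ * ‖y‖ + |c| * |s| * ‖x‖ + |c| * |s| * ‖y‖
              + |c| * ‖x‖ * ‖y‖ + |s| * ‖x‖ * ‖y‖ + |c| * |s| * ‖x‖ * ‖y‖) := by ring
          have : 0 ≤ (|c| + ‖x‖ + |s| + ‖y‖ + |c| * |s| + |c| * ‖y‖
              + |s| * ‖x‖ + ‖x‖ * ‖y‖ + |c| * |s| * ‖x‖ + |c| * |s| * ‖y‖
              + |c| * ‖x‖ * ‖y‖ + |s| * ‖x‖ * ‖y‖ + |c| * |s| * ‖x‖ * ‖y‖) := by positivity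
          linarith
      _ = _ := by rw [integral_mul_const, integral_const_mul]

variable (hγ : ∫ x, x ∂γ = 0)

include hγ in
lemma refl_map {c s : ℝ} (h : c ^ 2 + s ^ 2 = 1) :
    (γ.prod γ).map (fun z : E × E => (c • z.1 + s • z.2, s • z.1 - c • z.2)) = γ.prod γ := by
  have h0 : ∀ L : StrongDual ℝ E, γ[L] = 0 := fun L => by
    rw [IsGaussian.integral_dual, hγ, map_zero]
  let R : E × E →L[ℝ] E × E := (lc c s).prod (lc s (-c))
  have hR : (fun z : E × E => (c • z.1 + s • z.2, s • z.1 - c • z.2)) = R := by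
    ext z <;> simp [R, lc_apply, sub_eq_add_neg]
  rw [hR]
  refine Measure.ext_of_charFunDual ?_
  ext L
  have key : ∀ a b : StrongDual ℝ E, ∀ p q : ℝ, Var[(p • a + q • b : StrongDual ℝ E); γ]
      = p ^ 2 * Var[a; γ] + 2 * p * q * cov[a, b; γ] + q ^ 2 * Var[b; γ] := by
    intro a b p q
    have ha := IsGaussian.memLp_dual γ a 2 (by simp)
    have hb := IsGaussian.memLp_dual γ b 2 (by simp)
    have e : ⇑(p • a + q • b : StrongDual ℝ E) = (p • ⇑a) + (q • ⇑b) := rfl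
    rw [e, variance_add (ha.const_smul p) (hb.const_smul q), variance_smul, variance_smul,
      covariance_smul_left, covariance_smul_right]
    ring
  simp_rw [charFunDual_map, charFunDual_prod,
    IsGaussian.charFunDual_eq_of_forall_strongDual_eq_zero h0, ← Complex.exp_add]
  have e1 : (L ∘SL R) ∘SL (ContinuousLinearMap.inl ℝ E E) =
      c • (L ∘SL ContinuousLinearMap.inl ℝ E E) + s • (L ∘SL ContinuousLinearMap.inr ℝ E E) := by
    ext x
    simp only [R, lc, ContinuousLinearMap.comp_apply, _root_.add_apply,
      _root_.smul_apply, ← map_smul, ← map_add]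
    simp
  have e2 : (L ∘SL R) ∘SL (ContinuousLinearMap.inr ℝ E E) =
      s • (L ∘SL ContinuousLinearMap.inl ℝ E E) + (-c) • (L ∘SL ContinuousLinearMap.inr ℝ E E) := by
    ext x
    simp only [R, lc, ContinuousLinearMap.comp_apply, _root_.add_apply,
      _root_.smul_apply, ← map_smul, ← map_add]
    simp
  rw [e1, e2, key, key]
  clear e1 e2
  generalize (L ∘SL ContinuousLinearMap.inl ℝ E E) = a
  generalize (L ∘SL ContinuousLinearMap.inr ℝ E E) = b
  congr 1
  have hc : (c:ℂ) ^ 2 + (s:ℂ) ^ 2 = 1 := by exact_mod_cast h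
  push_cast
  linear_combination (-(Var[a; γ] : ℂ) / 2 - (Var[b; γ] : ℂ) / 2) * hc

include hγ in
/-- exchangeability of the correlated pair -/
lemma pair_symm {c s : ℝ} (h : c ^ 2 + s ^ 2 = 1) {W : E × E → ℝ} (hW : Measurable W) :
    ∫ z, W (c • z.1 + s • z.2, z.1) ∂(γ.prod γ) = ∫ z, W (z.1, c • z.1 + s • z.2) ∂(γ.prod γ) := by
  have hm : Measurable (fun z : E × E => (c • z.1 + s • z.2, z.1)) := by fun_prop
  conv_lhs => rw [← refl_map γ hγ h]
  rw [integral_map (f := fun z : E × E => W (c • z.1 + s • z.2, z.1)) (by fun_prop)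
    (hW.comp hm).aestronglyMeasurable]
  congr 1
  ext z
  congr 2
  have : c • (c • z.1 + s • z.2) + s • (s • z.1 - c • z.2) = (c ^ 2 + s ^ 2) • z.1 := by
    module
  simp only [this, h, one_smul]

lemma T_pair {c s : ℝ} {u v : E → ℝ} (hu : PG u) (hv : PG v) :
    ∫ x, u x * T γ c s v x ∂γ = ∫ z, u z.1 * v (c • z.1 + s • z.2) ∂(γ.prod γ) := by
  have hp : PG (fun z : E × E => u z.1 * v (c • z.1 + s • z.2)) := hu.fst.mul (hv.lc c s)
  rw [integral_prod _ (hp.integrable _)]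
  congr 1
  ext x
  simp only [T]
  rw [integral_const_mul]

include hγ in
lemma T_adj {c s : ℝ} (h : c ^ 2 + s ^ 2 = 1) {u v : E → ℝ} (hu : PG u) (hv : PG v) :
    ∫ x, u x * T γ c s v x ∂γ = ∫ x, T γ c s u x * v x ∂γ := by
  rw [T_pair γ hu hv]
  simp_rw [mul_comm (T γ c s u _)]
  rw [T_pair γ hv hu]
  have := pair_symm γ hγ h (W := fun z => v z.1 * u z.2)
    ((hv.1.comp measurable_fst).mul (hu.1.comp measurable_snd))
  simp only at this
  rw [← this]
  congr 1; ext z; ring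

include hγ in
lemma T_int {c s : ℝ} (h : c ^ 2 + s ^ 2 = 1) {u : E → ℝ} (hu : PG u) :
    ∫ x, T γ c s u x ∂γ = ∫ x, u x ∂γ := by
  have := T_adj γ hγ h hu (PG.const 1)
  simpa [T] using this.symm

include hγ in
lemma map_pair {c s : ℝ} (h : c ^ 2 + s ^ 2 = 1) {u : E → ℝ} (hu : PG u) :
    ∫ z, u (c • z.1 + s • z.2) ∂(γ.prod γ) = ∫ x, u x ∂γ := by
  have := T_pair γ (c := c) (s := s) (PG.const 1) hu
  simp only [one_mul] at this
  rw [← this, T_int γ hγ h hu]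

end PGsec

open MeasureTheory ProbabilityTheory Real

section Vsec

lemma PG.of_bdd {E : Type*} [NormedAddCommGroup E] [MeasurableSpace E] {u : E → ℝ}
    (hm : Measurable u) {A : ℝ} (h : ∀ z, |u z| ≤ A) : PG u :=
  ⟨hm, |A|, abs_nonneg _, 0, fun z => by simpa using (h z).trans (le_abs_self A)⟩

lemma integral_cs {Ω : Type*} [MeasurableSpace Ω] (μ : Measure Ω) {u v : Ω → ℝ}
    (hu : Integrable (fun x => u x ^ 2) μ) (hv : Integrable (fun x => v x ^ 2) μ)
    (huv : Integrable (fun x => u x * v x) μ) :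
    (∫ x, u x * v x ∂μ) ^ 2 ≤ (∫ x, u x ^ 2 ∂μ) * ∫ x, v x ^ 2 ∂μ := by
  have h : ∀ t : ℝ, 0 ≤ (∫ x, v x ^ 2 ∂μ) * (t * t) + (2 * ∫ x, u x * v x ∂μ) * t
      + ∫ x, u x ^ 2 ∂μ := by
    intro t
    have : (∫ x, v x ^ 2 ∂μ) * (t * t) + (2 * ∫ x, u x * v x ∂μ) * t
      + ∫ x, u x ^ 2 ∂μ = ∫ x, (u x + t * v x) ^ 2 ∂μ := by
      have e : ∀ x, (u x + t * v x) ^ 2 = (t * t) * v x ^ 2 + (2 * t) * (u x * v x) + u x ^ 2 := by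
        intro x; ring
      simp_rw [e]
      have i12 : Integrable (fun x => (t * t) * v x ^ 2 + (2 * t) * (u x * v x)) μ :=
        (hv.const_mul _).add (huv.const_mul _)
      rw [integral_add i12 hu,
        integral_add (hv.const_mul _) (huv.const_mul _), integral_const_mul, integral_const_mul]
      ring
    rw [this]
    exact integral_nonneg fun x => sq_nonneg _
  have := discrim_le_zero h
  rw [discrim] at this
  nlinarith

variable {ι : Type*} [Fintype ι]

/-- subgradient-type inequality -/
def SG (u : (ι → ℝ) → ℝ) (p : ι → (ι → ℝ) → ℝ) (a : ℝ) : Prop :=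
  ∀ x x', u x - u x' ≤ a * ∑ i, (x i - x' i) * p i x

variable (γ : Measure (ι → ℝ)) [IsGaussian γ]

lemma SG.T {u : (ι → ℝ) → ℝ} {p : ι → (ι → ℝ) → ℝ} {a : ℝ} (h : SG u p a) (hu : PG u)
    (hp : ∀ i, PG (p i)) (c s : ℝ) :
    SG (_root_.T γ c s u) (fun i => _root_.T γ c s (p i)) (c * a) := by
  intro x x'
  have hr : c * a * ∑ i, (x i - x' i) * _root_.T γ c s (p i) x =
      ∫ y, a * ∑ i, (c * (x i - x' i)) * p i (c • x + s • y) ∂γ := by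
    rw [integral_const_mul, integral_finsetSum _ fun i _ => ((hp i).slice γ c s x).const_mul _]
    simp_rw [integral_const_mul]
    simp only [_root_.T, Finset.mul_sum]
    exact Finset.sum_congr rfl fun i _ => by ring
  rw [hr]
  simp only [_root_.T]
  rw [← integral_sub (hu.slice γ c s x) (hu.slice γ c s x')]
  refine integral_mono ((hu.slice γ c s x).sub (hu.slice γ c s x')) ?_ fun y => ?_
  · exact (integrable_finsetSum _ fun i _ => ((hp i).slice γ c s x).const_mul _).const_mul _
  · refine (h _ _).trans_eq ?_
    congr 1
    refine Finset.sum_congr rfl fun i _ => ?_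
    simp only [Pi.add_apply, Pi.smul_apply, smul_eq_mul]
    ring

lemma PG.coord (i : ι) : PG (fun x : ι → ℝ => x i) :=
  PG.clm (ContinuousLinearMap.proj (R := ℝ) (φ := fun _ : ι => ℝ) i)

lemma PG.coord2 (i : ι) : PG (fun x : (ι → ℝ) × (ι → ℝ) => x.2 i) :=
  PG.clm ((ContinuousLinearMap.proj (R := ℝ) (φ := fun _ : ι => ℝ) i).comp
    (ContinuousLinearMap.snd ℝ (ι → ℝ) (ι → ℝ)))

/-- total second moment -/
noncomputable def Bn : ℝ := ∫ x, ∑ i, x i ^ 2 ∂γ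

/-- quadratic form of the weights -/
noncomputable def Wq (p : ι → (ι → ℝ) → ℝ) : ℝ :=
  ∫ x, ∑ i, ∑ j, (∫ y, y i * y j ∂γ) * (p i x * p j x) ∂γ

omit [Fintype ι] in
lemma wsum_sq_le [Fintype ι] {p : ι → ℝ} (hp : ∀ i, 0 ≤ p i) (hs : ∑ i, p i = 1) (x : ι → ℝ) :
    (∑ i, x i * p i) ^ 2 ≤ ∑ i, x i ^ 2 := by
  have h1 : ∀ i, p i ≤ 1 := fun i => hs ▸ Finset.single_le_sum (fun j _ => hp j) (Finset.mem_univ i)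
  have h2 := Finset.sum_mul_sq_le_sq_mul_sq Finset.univ x p
  have h3 : ∑ i, p i ^ 2 ≤ 1 := by
    rw [← hs]; exact Finset.sum_le_sum fun i _ => by nlinarith [hp i, h1 i]
  have h4 : 0 ≤ ∑ i, x i ^ 2 := Finset.sum_nonneg fun i _ => sq_nonneg _
  nlinarith

lemma Wq_eq {p : ι → (ι → ℝ) → ℝ} (hp : ∀ i, PG (p i)) :
    ∫ z, (∑ i, z.2 i * p i z.1) ^ 2 ∂(γ.prod γ) = Wq γ p := by
  have hpg : PG (fun z : (ι → ℝ) × (ι → ℝ) => (∑ i, z.2 i * p i z.1) ^ 2) :=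
    (PG.sum _ fun i _ => (PG.coord2 i).mul (hp i).fst).sq
  rw [integral_prod _ (hpg.integrable _), Wq]
  congr 1
  ext x
  have e : ∀ y : ι → ℝ, (∑ i, y i * p i x) ^ 2 = ∑ i, ∑ j, (p i x * p j x) * (y i * y j) := by
    intro y
    rw [sq, Finset.sum_mul_sum]
    exact Finset.sum_congr rfl fun i _ => Finset.sum_congr rfl fun j _ => by ring
  simp_rw [e]
  have hI : ∀ i j, Integrable (fun y : ι → ℝ => (p i x * p j x) * (y i * y j)) γ := fun i j =>
    (((PG.coord i).mul (PG.coord j)).cmul _).integrable γ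
  rw [integral_finsetSum _ fun i _ => integrable_finsetSum _ fun j _ => hI i j]
  refine Finset.sum_congr rfl fun i _ => ?_
  rw [integral_finsetSum _ fun j _ => hI i j]
  refine Finset.sum_congr rfl fun j _ => ?_
  rw [integral_const_mul]; ring

lemma Wq_le_Bn {p : ι → (ι → ℝ) → ℝ} (hp : ∀ i, PG (p i)) (hp0 : ∀ i x, 0 ≤ p i x)
    (hp1 : ∀ x, ∑ i, p i x = 1) : Wq γ p ≤ Bn γ := by
  rw [← Wq_eq γ hp]
  have h2 : PG (fun z : (ι → ℝ) × (ι → ℝ) => ∑ i, z.2 i ^ 2) :=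
    PG.sum _ fun i _ => (PG.coord2 i).sq
  have hpg : PG (fun z : (ι → ℝ) × (ι → ℝ) => (∑ i, z.2 i * p i z.1) ^ 2) :=
    (PG.sum _ fun i _ => (PG.coord2 i).mul (hp i).fst).sq
  calc _ ≤ ∫ z : (ι → ℝ) × (ι → ℝ), ∑ i, z.2 i ^ 2 ∂(γ.prod γ) :=
        integral_mono (hpg.integrable _) (h2.integrable _)
          fun z => wsum_sq_le (fun i => hp0 i z.1) (hp1 z.1) z.2
    _ = Bn γ := by
        rw [integral_prod _ (h2.integrable _)]; simp [Bn]

variable (hγ : ∫ x, x ∂γ = 0)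

omit [Fintype ι] in
lemma sq_T_le [Fintype ι] (γ : Measure (ι → ℝ)) [IsGaussian γ] {u : (ι → ℝ) → ℝ} (hu : PG u)
    (c s : ℝ) (x : ι → ℝ) :
    (T γ c s u x) ^ 2 ≤ T γ c s (fun y => u y ^ 2) x := by
  have h := integral_cs γ (u := fun y => u (c • x + s • y)) (v := fun _ => (1:ℝ))
    (hu.sq.slice γ c s x) (by simp) (by simpa using hu.slice γ c s x)
  simpa [T] using h

include hγ in
lemma T_contr {c s : ℝ} (h : c ^ 2 + s ^ 2 = 1) {u : (ι → ℝ) → ℝ} (hu : PG u) :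
    ∫ x, (T γ c s u x) ^ 2 ∂γ ≤ ∫ x, u x ^ 2 ∂γ := by
  rw [← T_int γ hγ h hu.sq]
  exact integral_mono ((hu.T γ c s).sq.integrable γ) ((hu.sq.T γ c s).integrable γ)
    fun x => sq_T_le γ hu c s x

include hγ in
lemma step_ineq {c s a : ℝ} (h : c ^ 2 + s ^ 2 = 1) {g : (ι → ℝ) → ℝ}
    {p : ι → (ι → ℝ) → ℝ} (hg : PG g) (hp : ∀ i, PG (p i)) (hp0 : ∀ i x, 0 ≤ p i x)
    (hp1 : ∀ x, ∑ i, p i x = 1) (hS : SG g p a) :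
    ∫ x, g x ^ 2 ∂γ - ∫ x, (T γ c s g x) ^ 2 ∂γ ≤
      4 * a ^ 2 * ((1 - c) ^ 2 * Bn γ + s ^ 2 * Wq γ p) := by
  have hTg := hg.T γ c s
  have i1 := hg.sq.integrable γ
  have i2 := hTg.sq.integrable γ
  have i3 := (hg.mul hTg).integrable γ
  have A1 : ∫ x, g x ^ 2 ∂γ - ∫ x, (T γ c s g x) ^ 2 ∂γ ≤
      2 * (∫ x, g x ^ 2 ∂γ - ∫ x, g x * T γ c s g x ∂γ) := by
    have h0 : 0 ≤ ∫ x, (g x - T γ c s g x) ^ 2 ∂γ := integral_nonneg fun x => sq_nonneg _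
    have e : ∀ x, (g x - T γ c s g x) ^ 2 = g x ^ 2 - 2 * (g x * T γ c s g x)
        + (T γ c s g x) ^ 2 := fun x => by ring
    simp_rw [e] at h0
    have i12 : Integrable (fun x => g x ^ 2 - 2 * (g x * T γ c s g x)) γ :=
      i1.sub (i3.const_mul 2)
    rw [integral_add i12 i2, integral_sub i1 (i3.const_mul 2),
      integral_const_mul] at h0
    linarith
  have P1 : PG (fun z : (ι → ℝ) × (ι → ℝ) => g z.1 ^ 2) := hg.sq.fst
  have P2 : PG (fun z : (ι → ℝ) × (ι → ℝ) => g (c • z.1 + s • z.2) ^ 2) := hg.sq.lc c s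
  have P3 : PG (fun z : (ι → ℝ) × (ι → ℝ) => g z.1 * g (c • z.1 + s • z.2)) :=
    hg.fst.mul (hg.lc c s)
  have A2 : 2 * (∫ x, g x ^ 2 ∂γ - ∫ x, g x * T γ c s g x ∂γ) =
      ∫ z, (g z.1 - g (c • z.1 + s • z.2)) ^ 2 ∂(γ.prod γ) := by
    have e : ∀ z : (ι → ℝ) × (ι → ℝ), (g z.1 - g (c • z.1 + s • z.2)) ^ 2 =
      g z.1 ^ 2 - 2 * (g z.1 * g (c • z.1 + s • z.2)) + g (c • z.1 + s • z.2) ^ 2 :=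
        fun z => by ring
    simp_rw [e]
    have i12 : Integrable (fun z : (ι → ℝ) × (ι → ℝ) =>
        g z.1 ^ 2 - 2 * (g z.1 * g (c • z.1 + s • z.2))) (γ.prod γ) :=
      (P1.integrable _).sub ((P3.integrable _).const_mul 2)
    rw [integral_add i12 (P2.integrable _),
      integral_sub (P1.integrable _) ((P3.integrable _).const_mul 2), integral_const_mul,
      ← T_pair γ hg hg, map_pair γ hγ h hg.sq, integral_prod _ (P1.integrable _)]
    simp
    ring
  let q : (ι → ℝ) × (ι → ℝ) → ℝ := fun w => (a * ∑ i, (w.1 i - w.2 i) * p i w.1) ^ 2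
  have Pq : PG q := by
    refine (PG.cmul a (PG.sum _ fun i _ => PG.mul (PG.sub ?_ (PG.coord2 i)) (hp i).fst)).sq
    exact (PG.coord i).fst
  have Pq1 : PG (fun z : (ι → ℝ) × (ι → ℝ) => q (z.1, c • z.1 + s • z.2)) :=
    Pq.comp_clm ((ContinuousLinearMap.fst ℝ (ι → ℝ) (ι → ℝ)).prod (lc c s))
  have Pq2 : PG (fun z : (ι → ℝ) × (ι → ℝ) => q (c • z.1 + s • z.2, z.1)) :=
    Pq.comp_clm ((lc c s).prod (ContinuousLinearMap.fst ℝ (ι → ℝ) (ι → ℝ)))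
  have A3 : ∫ z, (g z.1 - g (c • z.1 + s • z.2)) ^ 2 ∂(γ.prod γ) ≤
      2 * ∫ z, q (z.1, c • z.1 + s • z.2) ∂(γ.prod γ) := by
    have e := pair_symm γ hγ h Pq.1
    rw [two_mul]
    nth_rewrite 2 [← e]
    rw [← integral_add (Pq1.integrable _) (Pq2.integrable _)]
    refine integral_mono ((hg.fst.sub (hg.lc c s)).sq.integrable _)
      ((Pq1.integrable _).add (Pq2.integrable _)) fun z => ?_
    have h1 := hS z.1 (c • z.1 + s • z.2)
    have h2 := hS (c • z.1 + s • z.2) z.1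
    simp only [q]
    generalize a * ∑ i, (z.1 i - (c • z.1 + s • z.2) i) * p i z.1 = q1 at *
    generalize a * ∑ i, ((c • z.1 + s • z.2) i - z.1 i) * p i (c • z.1 + s • z.2) = q2 at *
    have h3 : -q2 ≤ g z.1 - g (c • z.1 + s • z.2) := by linarith
    rcases le_total 0 (g z.1 - g (c • z.1 + s • z.2)) with h0 | h0
    · nlinarith [sq_nonneg q2]
    · nlinarith [sq_nonneg q1]
  have R1 : PG (fun z : (ι → ℝ) × (ι → ℝ) => ∑ i, z.1 i ^ 2) :=
    (PG.sum _ fun i _ => (PG.coord i).sq : PG (fun x : ι → ℝ => ∑ i, x i ^ 2)).fst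
  have R2 : PG (fun z : (ι → ℝ) × (ι → ℝ) => (∑ i, z.2 i * p i z.1) ^ 2) :=
    (PG.sum _ fun i _ => (PG.coord2 i).mul (hp i).fst).sq
  have A4 : ∫ z, q (z.1, c • z.1 + s • z.2) ∂(γ.prod γ) ≤
      2 * a ^ 2 * ((1 - c) ^ 2 * Bn γ + s ^ 2 * Wq γ p) := by
    have hb : ∫ z : (ι → ℝ) × (ι → ℝ), ∑ i, z.1 i ^ 2 ∂(γ.prod γ) = Bn γ := by
      rw [integral_prod _ (R1.integrable _)]; simp [Bn]
    rw [← hb, ← Wq_eq γ hp, ← integral_const_mul, ← integral_const_mul,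
      ← integral_add ((R1.integrable _).const_mul _) ((R2.integrable _).const_mul _),
      ← integral_const_mul]
    refine integral_mono (Pq1.integrable _)
      ((((R1.integrable _).const_mul _).add ((R2.integrable _).const_mul _)).const_mul _)
      fun z => ?_
    have e : ∑ i, (z.1 i - (c • z.1 + s • z.2) i) * p i z.1 =
        (1 - c) * ∑ i, z.1 i * p i z.1 - s * ∑ i, z.2 i * p i z.1 := by
      rw [Finset.mul_sum, Finset.mul_sum, ← Finset.sum_sub_distrib]
      refine Finset.sum_congr rfl fun i _ => ?_
      simp only [Pi.add_apply, Pi.smul_apply, smul_eq_mul]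
      ring
    have hx := wsum_sq_le (fun i => hp0 i z.1) (hp1 z.1) z.1
    simp only [q, e]
    have h5 := mul_le_mul_of_nonneg_left hx (sq_nonneg (1 - c))
    have h6 : ((1 - c) * ∑ i, z.1 i * p i z.1 - s * ∑ i, z.2 i * p i z.1) ^ 2 ≤
      2 * ((1 - c) ^ 2 * (∑ i, z.1 i ^ 2) + s ^ 2 * (∑ i, z.2 i * p i z.1) ^ 2) := by
      nlinarith [sq_nonneg ((1 - c) * ∑ i, z.1 i * p i z.1 + s * ∑ i, z.2 i * p i z.1)]
    rw [mul_pow]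
    nlinarith [mul_le_mul_of_nonneg_left h6 (sq_nonneg a)]
  linarith

/-- iterates -/
lemma PG.iter {u : (ι → ℝ) → ℝ} (hu : PG u) (c s : ℝ) (k : ℕ) : PG ((_root_.T γ c s)^[k] u) := by
  induction k with
  | zero => simpa using hu
  | succ k ih => rw [Function.iterate_succ_apply']; exact ih.T γ c s

lemma T_nonneg {u : (ι → ℝ) → ℝ} (hu : ∀ x, 0 ≤ u x) (c s : ℝ) (x : ι → ℝ) : 0 ≤ T γ c s u x :=
  integral_nonneg fun _ => hu _

lemma T_sum {κ : Type*} (D : Finset κ) {p : κ → (ι → ℝ) → ℝ} (hp : ∀ i, PG (p i)) (c s : ℝ) :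
    T γ c s (fun x => ∑ i ∈ D, p i x) = fun x => ∑ i ∈ D, T γ c s (p i) x := by
  ext x
  simp only [T]
  rw [integral_finsetSum _ fun i _ => (hp i).slice γ c s x]

lemma iter_sum {κ : Type*} (D : Finset κ) {p : κ → (ι → ℝ) → ℝ} (hp : ∀ i, PG (p i)) (c s : ℝ)
    (k : ℕ) :
    (T γ c s)^[k] (fun x => ∑ i ∈ D, p i x) = fun x => ∑ i ∈ D, (T γ c s)^[k] (p i) x := by
  induction k with
  | zero => rfl
  | succ k ih =>
    rw [Function.iterate_succ_apply', ih, T_sum γ D fun i => (hp i).iter γ c s k]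
    simp_rw [Function.iterate_succ_apply']

lemma iter_nonneg {u : (ι → ℝ) → ℝ} (hu : ∀ x, 0 ≤ u x) (c s : ℝ) (k : ℕ) (x : ι → ℝ) :
    0 ≤ (T γ c s)^[k] u x := by
  induction k generalizing x with
  | zero => exact hu x
  | succ k ih => rw [Function.iterate_succ_apply']; exact T_nonneg γ ih c s x

lemma iter_one (c s : ℝ) (k : ℕ) : (T γ c s)^[k] (fun _ => (1:ℝ)) = fun _ => 1 := by
  induction k with
  | zero => rfl
  | succ k ih => rw [Function.iterate_succ_apply', ih]; ext x; simp [T]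

lemma SG.iter {u : (ι → ℝ) → ℝ} {p : ι → (ι → ℝ) → ℝ} (h : SG u p 1) (hu : PG u)
    (hp : ∀ i, PG (p i)) (c s : ℝ) (k : ℕ) :
    SG ((_root_.T γ c s)^[k] u) (fun i => (_root_.T γ c s)^[k] (p i)) (c ^ k) := by
  induction k with
  | zero => simpa using h
  | succ k ih =>
    simp_rw [Function.iterate_succ_apply']
    rw [pow_succ, mul_comm]
    exact ih.T γ (hu.iter γ c s k) (fun i => (hp i).iter γ c s k) c s

include hγ in
lemma iter_int {c s : ℝ} (h : c ^ 2 + s ^ 2 = 1) {u : (ι → ℝ) → ℝ} (hu : PG u) (k : ℕ) :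
    ∫ x, (T γ c s)^[k] u x ∂γ = ∫ x, u x ∂γ := by
  induction k with
  | zero => rfl
  | succ k ih => rw [Function.iterate_succ_apply', T_int γ hγ h (hu.iter γ c s k), ih]

include hγ in
theorem var_sum_bound {c s : ℝ} (h : c ^ 2 + s ^ 2 = 1) {f : (ι → ℝ) → ℝ}
    {p : ι → (ι → ℝ) → ℝ} (hf : PG f) (hp : ∀ i, PG (p i)) (hp0 : ∀ i x, 0 ≤ p i x)
    (hp1 : ∀ x, ∑ i, p i x = 1) (hS : SG f p 1) (N : ℕ) :
    ∫ x, f x ^ 2 ∂γ - (∫ x, f x ∂γ) ^ 2 ≤ 8 * (c ^ N) ^ 2 * Bn γ +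
      ∑ k ∈ Finset.range N, 4 * (c ^ k) ^ 2 * ((1 - c) ^ 2 * Bn γ +
        s ^ 2 * Wq γ (fun i => (T γ c s)^[k] (p i))) := by
  have hp1' : ∀ k x, ∑ i, (T γ c s)^[k] (p i) x = 1 := by
    intro k x
    have := congrFun (iter_sum γ Finset.univ hp c s k) x
    rw [← this]
    simp only [hp1]
    rw [iter_one]
  have htel : ∫ x, f x ^ 2 ∂γ - ∫ x, ((T γ c s)^[N] f x) ^ 2 ∂γ ≤
      ∑ k ∈ Finset.range N, 4 * (c ^ k) ^ 2 * ((1 - c) ^ 2 * Bn γ +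
        s ^ 2 * Wq γ (fun i => (T γ c s)^[k] (p i))) := by
    have e : ∫ x, f x ^ 2 ∂γ - ∫ x, ((T γ c s)^[N] f x) ^ 2 ∂γ =
      ∑ k ∈ Finset.range N, (∫ x, ((T γ c s)^[k] f x) ^ 2 ∂γ
        - ∫ x, ((T γ c s)^[k+1] f x) ^ 2 ∂γ) := by
      rw [Finset.sum_range_sub' (fun k => ∫ x, ((T γ c s)^[k] f x) ^ 2 ∂γ)]
      rfl
    rw [e]
    refine Finset.sum_le_sum fun k _ => ?_
    rw [Function.iterate_succ_apply']
    exact step_ineq γ hγ h (hf.iter γ c s k) (fun i => (hp i).iter γ c s k)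
      (fun i x => iter_nonneg γ (hp0 i) c s k x) (hp1' k) (hS.iter γ hf hp c s k)
  have hend := step_ineq γ hγ (c := 0) (s := 1) (by norm_num) (hf.iter γ c s N)
      (fun i => (hp i).iter γ c s N)
      (fun i x => iter_nonneg γ (hp0 i) c s N x) (hp1' N) (hS.iter γ hf hp c s N)
  have hW := Wq_le_Bn γ (fun i => (hp i).iter γ c s N)
      (fun i x => iter_nonneg γ (hp0 i) c s N x) (hp1' N)
  have hT0 : ∀ x, T γ 0 1 ((T γ c s)^[N] f) x = ∫ x, f x ∂γ := by
    intro x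
    rw [← iter_int γ hγ h hf N]
    simp [T]
  simp_rw [hT0] at hend
  simp only [integral_const, probReal_univ, smul_eq_mul, one_mul, sub_zero, one_pow] at hend
  have := mul_le_mul_of_nonneg_left hW (sq_nonneg (c ^ N))
  linarith
end Vsec

open MeasureTheory ProbabilityTheory Real

section Hyp
open scoped ENNReal
open Filter Topology

/-- the analytic two-point inequality -/
lemma two_point_real (x y : ℝ) :
    ((3 * x + y) / 4) ^ 4 / 2 + ((x + 3 * y) / 4) ^ 4 / 2 ≤ (x ^ 2 / 2 + y ^ 2 / 2) ^ 2 := by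
  have e : (x ^ 2 / 2 + y ^ 2 / 2) ^ 2 -
      (((3 * x + y) / 4) ^ 4 / 2 + ((x + 3 * y) / 4) ^ 4 / 2) =
      (1 / 2) * ((x + y) / 2) ^ 2 * ((x - y) / 2) ^ 2 + (15 / 16) * ((x - y) / 2) ^ 4 := by ring
  have : 0 ≤ (1 / 2) * ((x + y) / 2) ^ 2 * ((x - y) / 2) ^ 2 + (15 / 16) * ((x - y) / 2) ^ 4 := by
    positivity
  linarith

lemma two_point_enn (x y : ℝ≥0∞) :
    (2⁻¹ : ℝ≥0∞) * ((3 * x + y) / 4) ^ 4 + 2⁻¹ * ((x + 3 * y) / 4) ^ 4 ≤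
      (2⁻¹ * x ^ 2 + 2⁻¹ * y ^ 2) ^ 2 := by
  by_cases hx : x = ⊤
  · subst hx; simp [ENNReal.mul_top, ENNReal.top_pow]
  by_cases hy : y = ⊤
  · subst hy; simp [ENNReal.mul_top, ENNReal.top_pow]
  lift x to NNReal using hx
  lift y to NNReal using hy
  have h := two_point_real x y
  have h' : (2⁻¹ : NNReal) * ((3 * x + y) / 4) ^ 4 + 2⁻¹ * ((x + 3 * y) / 4) ^ 4 ≤
      (2⁻¹ * x ^ 2 + 2⁻¹ * y ^ 2) ^ 2 := by
    rw [← NNReal.coe_le_coe]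
    push_cast
    linarith
  have h'' := ENNReal.coe_le_coe.2 h'
  push_cast [ENNReal.coe_div (show (4:NNReal) ≠ 0 by norm_num),
    ENNReal.coe_inv (show (2:NNReal) ≠ 0 by norm_num)] at h''
  exact h''

lemma half_split : ((2:ℝ≥0∞)⁻¹ ^ (1/4:ℝ)) * (2⁻¹ ^ (3/4:ℝ)) = 2⁻¹ := by
  rw [← ENNReal.rpow_add _ _ (by simp) (by simp)]
  norm_num

lemma two_point_hyp (f0 f1 g0 g1 : ℝ≥0∞) :
    2⁻¹ * ((3 * f0 + f1) / 4 * g0) + 2⁻¹ * ((f0 + 3 * f1) / 4 * g1) ≤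
      (2⁻¹ * f0 ^ (2:ℝ) + 2⁻¹ * f1 ^ (2:ℝ)) ^ (1/2:ℝ) *
        (2⁻¹ * g0 ^ (4/3:ℝ) + 2⁻¹ * g1 ^ (4/3:ℝ)) ^ (3/4:ℝ) := by
  have hc : Real.HolderConjugate 4 (4/3) := by
    rw [Real.holderConjugate_iff]; norm_num
  have h := ENNReal.inner_le_Lp_mul_Lq (Finset.univ : Finset (Fin 2))
    (![(2⁻¹ ^ (1/4:ℝ)) * ((3 * f0 + f1) / 4), (2⁻¹ ^ (1/4:ℝ)) * ((f0 + 3 * f1) / 4)])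
    (![(2⁻¹ ^ (3/4:ℝ)) * g0, (2⁻¹ ^ (3/4:ℝ)) * g1]) hc
  simp only [Fin.sum_univ_two, Matrix.cons_val_zero, Matrix.cons_val_one] at h
  have e1 : ∀ a b : ℝ≥0∞, (2⁻¹ ^ (1/4:ℝ)) * a * ((2⁻¹ ^ (3/4:ℝ)) * b) = 2⁻¹ * (a * b) := by
    intro a b
    calc _ = ((2⁻¹ ^ (1/4:ℝ)) * (2⁻¹ ^ (3/4:ℝ))) * (a * b) := by ring
      _ = _ := by rw [half_split]
  have e2 : ∀ a : ℝ≥0∞, ((2⁻¹ ^ (1/4:ℝ)) * a) ^ (4:ℝ) = 2⁻¹ * a ^ 4 := by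
    intro a
    rw [ENNReal.mul_rpow_of_nonneg _ _ (by norm_num), ← ENNReal.rpow_mul]
    norm_num
  have e3 : ∀ a : ℝ≥0∞, ((2⁻¹ ^ (3/4:ℝ)) * a) ^ (4/3:ℝ) = 2⁻¹ * a ^ (4/3:ℝ) := by
    intro a
    rw [ENNReal.mul_rpow_of_nonneg _ _ (by norm_num), ← ENNReal.rpow_mul]
    norm_num
  rw [e1, e1, e2, e2, e3, e3] at h
  refine h.trans ?_
  rw [show (1 / (4/3) : ℝ) = 3/4 by norm_num]
  gcongr
  calc _ ≤ ((2⁻¹ * f0 ^ 2 + 2⁻¹ * f1 ^ 2) ^ 2) ^ (1/4:ℝ) :=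
        ENNReal.rpow_le_rpow (two_point_enn f0 f1) (by norm_num)
    _ = _ := by
      rw [← ENNReal.rpow_ofNat, ← ENNReal.rpow_mul]
      norm_num

variable {H A : Type*} [AddCommGroup H] [MeasurableSpace H] [MeasurableAdd₂ H]
  [AddCommGroup A] [MeasurableSpace A] [MeasurableAdd₂ A]

/-- hypercontractive pair -/
def HypP (p q : H →+ A) (ρ : Measure H) : Prop :=
  ∀ f g : A → ℝ≥0∞, Measurable f → Measurable g →
    ∫⁻ z, f (p z) * g (q z) ∂ρ ≤
      (∫⁻ z, f (p z) ^ (2:ℝ) ∂ρ) ^ (1/2:ℝ) * (∫⁻ z, g (q z) ^ (4/3:ℝ) ∂ρ) ^ (3/4:ℝ)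

omit [MeasurableAdd₂ H] [MeasurableAdd₂ A] in
lemma HypP.dirac {p q : H →+ A} (hp : Measurable p) (hq : Measurable q) :
    HypP p q (Measure.dirac 0) := by
  intro f g hf hg
  rw [lintegral_dirac' _ (by fun_prop), lintegral_dirac' _ (by fun_prop),
    lintegral_dirac' _ (by fun_prop), ← ENNReal.rpow_mul, ← ENNReal.rpow_mul]
  norm_num

lemma HypP.conv {p q : H →+ A} (hp : Measurable p) (hq : Measurable q) {ρ ν : Measure H}
    [SFinite ρ] [SFinite ν] (h1 : HypP p q ρ) (h2 : HypP p q ν) : HypP p q (ρ.conv ν) := by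
  intro f g hf hg
  rw [Measure.lintegral_conv (by fun_prop), Measure.lintegral_conv (by fun_prop),
    Measure.lintegral_conv (by fun_prop)]
  let F : A → ℝ≥0∞ := fun a => (∫⁻ w, f (a + p w) ^ (2:ℝ) ∂ν) ^ (1/2:ℝ)
  let G : A → ℝ≥0∞ := fun a => (∫⁻ w, g (a + q w) ^ (4/3:ℝ) ∂ν) ^ (3/4:ℝ)
  have hF : Measurable F := by
    refine Measurable.pow_const ?_ _
    exact Measurable.lintegral_prod_right' (f := fun z : A × H => f (z.1 + p z.2) ^ (2:ℝ))
      (by fun_prop)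
  have hG : Measurable G := by
    refine Measurable.pow_const ?_ _
    exact Measurable.lintegral_prod_right' (f := fun z : A × H => g (z.1 + q z.2) ^ (4/3:ℝ))
      (by fun_prop)
  have hF2 : ∀ a, F a ^ (2:ℝ) = ∫⁻ w, f (a + p w) ^ (2:ℝ) ∂ν := by
    intro a; simp only [F]; rw [← ENNReal.rpow_mul]; norm_num
  have hG2 : ∀ a, G a ^ (4/3:ℝ) = ∫⁻ w, g (a + q w) ^ (4/3:ℝ) ∂ν := by
    intro a; simp only [G]; rw [← ENNReal.rpow_mul]; norm_num
  have h3 := h1 F G hF hG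
  simp_rw [hF2, hG2] at h3
  simp only [map_add]
  refine le_trans (lintegral_mono fun z => ?_) h3
  exact h2 (fun a => f (p z + a)) (fun a => g (q z + a)) (by fun_prop) (by fun_prop)

/-- The two point measure. -/
noncomputable def tp (v w : H) : Measure H :=
  (3/8 : ℝ≥0∞) • (Measure.dirac v + Measure.dirac (-v)) +
  (1/8 : ℝ≥0∞) • (Measure.dirac w + Measure.dirac (-w))

omit [MeasurableAdd₂ H] in
lemma tp_prob (v w : H) : IsProbabilityMeasure (tp v w) := by
  constructor
  simp only [tp, Measure.coe_add, Measure.coe_smul, Pi.add_apply, Pi.smul_apply, measure_univ,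
    smul_eq_mul]
  rw [← ENNReal.toReal_eq_one_iff]
  norm_num [ENNReal.toReal_add, ENNReal.toReal_mul, ENNReal.mul_eq_top, ENNReal.div_eq_top]

omit [MeasurableAdd₂ H] in
lemma tp_lintegral (v w : H) {f : H → ℝ≥0∞} (hf : Measurable f) :
    ∫⁻ z, f z ∂(tp v w) = 3/8 * (f v + f (-v)) + 1/8 * (f w + f (-w)) := by
  simp [tp, lintegral_add_measure, lintegral_smul_measure, lintegral_dirac' _ hf, mul_add]

lemma enn_aux1 (f0 f1 g0 g1 : ℝ≥0∞) : 3/8 * (f0 * g0 + f1 * g1) + 1/8 * (f0 * g1 + f1 * g0) =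
    2⁻¹ * ((3 * f0 + f1) / 4 * g0) + 2⁻¹ * ((f0 + 3 * f1) / 4 * g1) := by
  have h8 : (1/8 : ℝ≥0∞) = 2⁻¹ * 4⁻¹ := by
    rw [← ENNReal.mul_inv (by simp) (by simp)]; norm_num
  have h38 : (3/8 : ℝ≥0∞) = 3 * (2⁻¹ * 4⁻¹) := by
    rw [← h8, ← mul_div_assoc, mul_one]
  rw [h8, h38, ENNReal.div_eq_inv_mul, ENNReal.div_eq_inv_mul]
  ring

lemma enn_aux2 (a b : ℝ≥0∞) : 3/8 * (a + b) + 1/8 * (a + b) = 2⁻¹ * a + 2⁻¹ * b := by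
  have h8 : (1/8 : ℝ≥0∞) = 2⁻¹ * 4⁻¹ := by
    rw [← ENNReal.mul_inv (by simp) (by simp)]; norm_num
  have h38 : (3/8 : ℝ≥0∞) = 3 * (2⁻¹ * 4⁻¹) := by
    rw [← h8, ← mul_div_assoc, mul_one]
  rw [h8, h38, ← mul_add]
  have : (4 : ℝ≥0∞) * 4⁻¹ = 1 := ENNReal.mul_inv_cancel (by simp) (by simp)
  calc _ = 2⁻¹ * (a + b) * (4 * 4⁻¹) := by ring
    _ = _ := by rw [this, mul_one]

omit [MeasurableAdd₂ H] [MeasurableAdd₂ A] in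
lemma HypP.tp {p q : H →+ A} (hp : Measurable p) (hq : Measurable q) {v w : H} {b : A}
    (h1 : p v = b) (h2 : q v = b) (h3 : p w = b) (h4 : q w = -b) : HypP p q (tp v w) := by
  intro f g hf hg
  rw [tp_lintegral _ _ (by fun_prop), tp_lintegral _ _ (by fun_prop),
    tp_lintegral _ _ (by fun_prop)]
  simp only [map_neg, h1, h2, h3, h4, neg_neg]
  rw [enn_aux1, enn_aux2, add_comm (g (-b) ^ (4/3:ℝ)) (g b ^ (4/3:ℝ)), enn_aux2]
  exact two_point_hyp _ _ _ _

end Hyp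

open MeasureTheory ProbabilityTheory Real

section HypG
open scoped ENNReal RealInnerProductSpace
open Filter Topology

lemma tendsto_cos_scale (a : ℝ) :
    Tendsto (fun N : ℕ => (N:ℝ) * (Real.cos (a / √N) - 1)) atTop (𝓝 (-(a ^ 2) / 2)) := by
  rw [tendsto_iff_norm_sub_tendsto_zero]
  have hlim : Tendsto (fun N : ℕ => a ^ 4 * (5/96) * (N:ℝ)⁻¹) atTop (𝓝 0) := by
    have h := (tendsto_inv_atTop_nhds_zero_nat (𝕜 := ℝ)).const_mul (a ^ 4 * (5/96))
    rwa [mul_zero] at h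
  refine squeeze_zero' (Eventually.of_forall fun _ => norm_nonneg _) ?_ hlim
  obtain ⟨N0, hN0⟩ := exists_nat_ge (a ^ 2)
  filter_upwards [eventually_ge_atTop (max N0 1)] with N hN
  have hN1 : (1:ℝ) ≤ N := by exact_mod_cast (le_max_right _ _).trans hN
  have hNa : a ^ 2 ≤ N := hN0.trans (by exact_mod_cast (le_max_left _ _).trans hN)
  have hpos : (0:ℝ) < N := by linarith
  have hsq : (a / √N) ^ 2 = a ^ 2 / N := by rw [div_pow, Real.sq_sqrt hpos.le]
  have hb : |a / √N| ≤ 1 := by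
    rw [← sq_le_one_iff_abs_le_one, hsq, div_le_one hpos]; exact hNa
  have := Real.cos_bound hb
  have h4 : |a / √N| ^ 4 = a ^ 4 / N ^ 2 := by
    rw [show (4:ℕ) = 2 * 2 by norm_num, pow_mul, sq_abs, hsq]; ring
  rw [h4, hsq] at this
  rw [Real.norm_eq_abs]
  have e : (N:ℝ) * (Real.cos (a / √N) - 1) - -a ^ 2 / 2 =
      N * (Real.cos (a / √N) - (1 - a ^ 2 / N / 2)) := by field_simp; ring
  rw [e, abs_mul, abs_of_pos hpos]
  calc _ ≤ (N:ℝ) * (a ^ 4 / N ^ 2 * (5 / 96)) := by gcongr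
    _ = _ := by field_simp

variable {ι : Type*} [Fintype ι]

/-- ambient space -/
abbrev HH (ι : Type*) := EuclideanSpace ℝ (ι ⊕ ι)

/-- pair vector -/
def pv (b c : ι → ℝ) : HH ι := WithLp.toLp 2 (Sum.elim b c)

/-- projections -/
def pp : HH ι →+ (ι → ℝ) where
  toFun z := fun i => z (Sum.inl i)
  map_zero' := rfl
  map_add' _ _ := rfl

/-- projections -/
def qq : HH ι →+ (ι → ℝ) where
  toFun z := fun i => z (Sum.inr i)
  map_zero' := rfl
  map_add' _ _ := rfl

lemma pp_cont : Continuous (pp : HH ι →+ (ι → ℝ)) := by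
  show Continuous fun z : HH ι => fun i => z (Sum.inl i)
  fun_prop

lemma qq_cont : Continuous (qq : HH ι →+ (ι → ℝ)) := by
  show Continuous fun z : HH ι => fun i => z (Sum.inr i)
  fun_prop

lemma pv_inner (b c : ι → ℝ) (t : HH ι) :
    ⟪pv b c, t⟫ = ∑ i, b i * pp t i + ∑ i, c i * qq t i := by
  simp [pv, PiLp.inner_apply, mul_comm]
  rfl

lemma tp_integral {H : Type*} [AddCommGroup H] [MeasurableSpace H] (v w : H) {f : H → ℂ}
    (hf : StronglyMeasurable f) :
    ∫ z, f z ∂(tp v w) = 3/8 * (f v + f (-v)) + 1/8 * (f w + f (-w)) := by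
  have hd : ∀ v : H, Integrable f (Measure.dirac v) := fun v =>
    (integrable_dirac' hf (by simp))
  have h1 := (hd v).add_measure (hd (-v))
  have h2 := (hd w).add_measure (hd (-w))
  rw [tp, integral_add_measure (h1.smul_measure (by simp [ENNReal.div_eq_top]))
    (h2.smul_measure (by simp [ENNReal.div_eq_top])),
    integral_smul_measure, integral_smul_measure, integral_add_measure (hd _) (hd _),
    integral_add_measure (hd _) (hd _), integral_dirac' _ _ hf, integral_dirac' _ _ hf,
    integral_dirac' _ _ hf, integral_dirac' _ _ hf]
  simp [ENNReal.toReal_div, mul_add]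

lemma tp_charFun (v w t : HH ι) :
    charFun (tp v w) t = ((3/4 * Real.cos ⟪v, t⟫ + 1/4 * Real.cos ⟪w, t⟫ : ℝ) : ℂ) := by
  rw [charFun_apply, tp_integral]
  · simp only [inner_neg_left]
    push_cast
    rw [Complex.cos, Complex.cos]
    ring_nf
  · exact Continuous.stronglyMeasurable (by fun_prop)

lemma hyp_pow {ρ : Measure (HH ι)} [IsProbabilityMeasure ρ] (h : HypP pp qq ρ) (k : ℕ) :
    ∃ μ : Measure (HH ι), IsProbabilityMeasure μ ∧ HypP pp qq μ ∧
      ∀ t, charFun μ t = (charFun ρ t) ^ k := by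
  induction k with
  | zero => exact ⟨Measure.dirac 0, inferInstance,
      HypP.dirac pp_cont.measurable qq_cont.measurable, fun t => by simp⟩
  | succ k ih =>
    obtain ⟨μ, h1, h2, h3⟩ := ih
    exact ⟨μ.conv ρ, inferInstance, h2.conv pp_cont.measurable qq_cont.measurable h,
      fun t => by rw [charFun_conv, h3, pow_succ]⟩

lemma hyp_prod {κ : Type*} (D : Finset κ) {F : κ → HH ι → ℂ}
    (h : ∀ j, ∃ μ : Measure (HH ι), IsProbabilityMeasure μ ∧ HypP pp qq μ ∧
      ∀ t, charFun μ t = F j t) :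
    ∃ μ : Measure (HH ι), IsProbabilityMeasure μ ∧ HypP pp qq μ ∧
      ∀ t, charFun μ t = ∏ j ∈ D, F j t := by
  classical
  induction D using Finset.induction_on with
  | empty => exact ⟨Measure.dirac 0, inferInstance,
      HypP.dirac pp_cont.measurable qq_cont.measurable, fun t => by simp⟩
  | insert a s ha ih =>
    obtain ⟨μ, h1, h2, h3⟩ := ih
    obtain ⟨ν, g1, g2, g3⟩ := h a
    exact ⟨ν.conv μ, inferInstance, g2.conv pp_cont.measurable qq_cont.measurable h2,
      fun t => by rw [charFun_conv, h3, g3, Finset.prod_insert ha]⟩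

/-- approximating measures -/
lemma hyp_approx {m : ℕ} (b : Fin m → ι → ℝ) (N : ℕ) :
    ∃ μ : Measure (HH ι), IsProbabilityMeasure μ ∧ HypP pp qq μ ∧
      ∀ t, charFun μ t = ∏ j, (((3/4 * Real.cos ((∑ i, b j i * pp t i + ∑ i, b j i * qq t i) / √N)
        + 1/4 * Real.cos ((∑ i, b j i * pp t i - ∑ i, b j i * qq t i) / √N) : ℝ) : ℂ)) ^ N := by
  refine hyp_prod Finset.univ fun j => ?_
  let c : ι → ℝ := (√N)⁻¹ • b j
  have := tp_prob (pv c c) (pv c (-c))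
  obtain ⟨μ, h1, h2, h3⟩ := hyp_pow (ρ := tp (pv c c) (pv c (-c)))
    (HypP.tp (b := c) pp_cont.measurable qq_cont.measurable rfl rfl rfl rfl) N
  refine ⟨μ, h1, h2, fun t => ?_⟩
  rw [h3, tp_charFun, pv_inner, pv_inner]
  congr 6
  · simp only [c, Pi.smul_apply, smul_eq_mul, div_eq_inv_mul, mul_add, Finset.mul_sum, mul_assoc]
  · simp only [c, Pi.smul_apply, smul_eq_mul, div_eq_inv_mul, mul_add, Finset.mul_sum, mul_assoc,
      Pi.neg_apply, neg_mul, mul_neg, Finset.sum_neg_distrib, sub_eq_add_neg]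

lemma hyp_lim {m : ℕ} (b : Fin m → ι → ℝ) (t : HH ι) :
    Tendsto (fun N : ℕ => ∏ j, (((3/4 * Real.cos ((∑ i, b j i * pp t i + ∑ i, b j i * qq t i) / √N)
        + 1/4 * Real.cos ((∑ i, b j i * pp t i - ∑ i, b j i * qq t i) / √N) : ℝ) : ℂ)) ^ N) atTop
      (𝓝 (((Real.exp (-(∑ j, ((∑ i, b j i * (pp t i + 1/2 * qq t i)) ^ 2 +
        3/4 * (∑ i, b j i * qq t i) ^ 2)) / 2) : ℝ) : ℂ))) := by
  have h1 : ∀ x y : ℝ, Tendsto (fun N : ℕ => (3/4 * Real.cos ((x + y) / √N)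
      + 1/4 * Real.cos ((x - y) / √N)) ^ N) atTop
      (𝓝 (Real.exp (-((x + 1/2 * y) ^ 2 + 3/4 * y ^ 2) / 2))) := by
    intro x y
    have h := Real.tendsto_one_add_pow_exp_of_tendsto
      (g := fun N : ℕ => 3/4 * Real.cos ((x + y) / √N) + 1/4 * Real.cos ((x - y) / √N) - 1)
      (t := -((x + 1/2 * y) ^ 2 + 3/4 * y ^ 2) / 2) ?_
    · simpa using h
    · have := ((tendsto_cos_scale (x + y)).const_mul (3/4)).add
        ((tendsto_cos_scale (x - y)).const_mul (1/4))
      convert this using 2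
      · ring
      · ring
  have h2 : Real.exp (-(∑ j, ((∑ i, b j i * (pp t i + 1/2 * qq t i)) ^ 2 +
        3/4 * (∑ i, b j i * qq t i) ^ 2)) / 2) =
      ∏ j, Real.exp (-((∑ i, b j i * pp t i + 1/2 * ∑ i, b j i * qq t i) ^ 2 +
        3/4 * (∑ i, b j i * qq t i) ^ 2) / 2) := by
    rw [← Real.exp_sum, ← Finset.sum_div, ← Finset.sum_neg_distrib]
    congr 3
    ext j
    congr 3
    simp only [mul_add, Finset.sum_add_distrib, Finset.mul_sum]
    congr 2
    ext i; ring
  rw [h2]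
  push_cast
  refine tendsto_finsetProd _ fun j _ => ?_
  have := (Complex.continuous_ofReal.tendsto _).comp
    (h1 (∑ i, b j i * pp t i) (∑ i, b j i * qq t i))
  convert this using 2
  · simp
  · push_cast; rfl

lemma cov_factor (γ : Measure (ι → ℝ)) [IsGaussian γ] :
    ∃ (m : ℕ) (b : Fin m → ι → ℝ), ∀ a : ι → ℝ,
      ∫ x, (∑ i, x i * a i) ^ 2 ∂γ = ∑ j, (∑ i, b j i * a i) ^ 2 := by
  let M : Matrix ι ι ℝ := fun i j => ∫ x, x i * x j ∂γ
  have hq : ∀ a : ι → ℝ, ∫ x, (∑ i, x i * a i) ^ 2 ∂γ = ∑ i, ∑ j, a i * (M i j * a j) := by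
    intro a
    have hI : ∀ i j, Integrable (fun y : ι → ℝ => (a i * a j) * (y i * y j)) γ := fun i j =>
      (((PG.coord i).mul (PG.coord j)).cmul _).integrable γ
    have e : ∀ y : ι → ℝ, (∑ i, y i * a i) ^ 2 = ∑ i, ∑ j, (a i * a j) * (y i * y j) := by
      intro y
      rw [sq, Finset.sum_mul_sum]
      exact Finset.sum_congr rfl fun i _ => Finset.sum_congr rfl fun j _ => by ring
    simp_rw [e]
    rw [integral_finsetSum _ fun i _ => integrable_finsetSum _ fun j _ => hI i j]
    refine Finset.sum_congr rfl fun i _ => ?_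
    rw [integral_finsetSum _ fun j _ => hI i j]
    refine Finset.sum_congr rfl fun j _ => ?_
    rw [integral_const_mul]; simp only [M]; ring
  have hM : M.PosSemidef := by
    refine Matrix.PosSemidef.of_dotProduct_mulVec_nonneg ?_ fun a => ?_
    · ext i j
      rw [Matrix.conjTranspose_apply, star_trivial]
      exact integral_congr_ae (Eventually.of_forall fun x => mul_comm _ _)
    · have : star a ⬝ᵥ (M.mulVec a) = ∑ i, ∑ j, a i * (M i j * a j) := by
        simp [dotProduct, Matrix.mulVec, Finset.mul_sum]
      rw [this, ← hq]
      exact integral_nonneg fun x => sq_nonneg _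
  obtain ⟨m, b, hb⟩ := Matrix.posSemidef_iff_eq_sum_vecMulVec.1 hM
  refine ⟨m, b, fun a => ?_⟩
  rw [hq, hb]
  simp only [Matrix.sum_apply, Matrix.vecMulVec_apply, star_trivial, Finset.sum_mul,
    Finset.mul_sum, sq]
  have e2 : ∀ i : ι, ∑ j, ∑ k, a i * (b k i * b k j * a j) =
      ∑ k, ∑ j, a i * (b k i * b k j * a j) := fun i => Finset.sum_comm
  simp only [e2]
  rw [Finset.sum_comm]
  refine Finset.sum_congr rfl fun k _ => ?_
  rw [Finset.sum_comm]
  refine Finset.sum_congr rfl fun i _ => Finset.sum_congr rfl fun j _ => by ring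

/-- embedding of the correlated pair -/
noncomputable def Lm : ((ι → ℝ) × (ι → ℝ)) →L[ℝ] HH ι :=
  LinearMap.toContinuousLinearMap
    { toFun := fun z => pv z.1 ((1/2:ℝ) • z.1 + (√3/2) • z.2)
      map_add' := fun x y => by
        ext i
        rcases i with i | i
        · simp [pv]
        · simp [pv]; ring
      map_smul' := fun c x => by
        ext i
        rcases i with i | i
        · simp [pv]
        · simp [pv]; ring }

lemma Lm_apply (z : (ι → ℝ) × (ι → ℝ)) : Lm z = pv z.1 ((1/2:ℝ) • z.1 + (√3/2) • z.2) := rfl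

lemma dual_char (γ : Measure (ι → ℝ)) [IsGaussian γ] (hγ : ∫ x, x ∂γ = 0)
    (L : StrongDual ℝ (ι → ℝ)) (a : ι → ℝ) (hL : ∀ x, L x = ∑ i, x i * a i) :
    charFunDual γ L = ((Real.exp (-(∫ x, (∑ i, x i * a i) ^ 2 ∂γ) / 2) : ℝ) : ℂ) := by
  have h0 : ∀ L : StrongDual ℝ (ι → ℝ), γ[L] = 0 := fun L => by
    rw [IsGaussian.integral_dual, hγ, map_zero]
  rw [IsGaussian.charFunDual_eq_of_forall_strongDual_eq_zero h0]
  have hv : Var[L; γ] = ∫ x, (∑ i, x i * a i) ^ 2 ∂γ := by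
    rw [variance_of_integral_eq_zero (by fun_prop) (h0 L)]
    congr 1; ext x; simp [hL]
  rw [hv]
  push_cast
  ring_nf

lemma Lm_charFun (γ : Measure (ι → ℝ)) [IsGaussian γ] (hγ : ∫ x, x ∂γ = 0) {m : ℕ}
    {b : Fin m → ι → ℝ} (hb : ∀ a : ι → ℝ,
      ∫ x, (∑ i, x i * a i) ^ 2 ∂γ = ∑ j, (∑ i, b j i * a i) ^ 2) (t : HH ι) :
    charFun ((γ.prod γ).map Lm) t =
      (((Real.exp (-(∑ j, ((∑ i, b j i * (pp t i + 1/2 * qq t i)) ^ 2 +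
        3/4 * (∑ i, b j i * qq t i) ^ 2)) / 2) : ℝ) : ℂ)) := by
  rw [charFun_eq_charFunDual_toDualMap, charFunDual_map, charFunDual_prod,
    dual_char γ hγ _ (fun i => pp t i + 1/2 * qq t i), dual_char γ hγ _ (fun i => √3/2 * qq t i),
    hb, hb, ← Complex.ofReal_mul, ← Real.exp_add]
  · congr 2
    have e : ∀ j, ∑ i, b j i * (√3/2 * qq t i) = √3/2 * ∑ i, b j i * qq t i := by
      intro j; rw [Finset.mul_sum]; exact Finset.sum_congr rfl fun i _ => by ring
    simp only [e, mul_pow, div_pow, Real.sq_sqrt (show (0:ℝ) ≤ 3 by norm_num)]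
    rw [Finset.sum_add_distrib]
    norm_num
    ring
  · intro x
    simp only [ContinuousLinearMap.comp_apply, InnerProductSpace.toDualMap_apply_apply,
      ContinuousLinearMap.inr_apply, Lm_apply, real_inner_comm]
    rw [real_inner_comm, pv_inner]
    simp
    exact Finset.sum_congr rfl fun i _ => by ring
  · intro x
    simp only [ContinuousLinearMap.comp_apply, InnerProductSpace.toDualMap_apply_apply,
      ContinuousLinearMap.inl_apply, Lm_apply]
    rw [real_inner_comm, pv_inner, ← Finset.sum_add_distrib]
    simp
    exact Finset.sum_congr rfl fun i _ => by ring

lemma HypP.real {μ : Measure (HH ι)} [IsProbabilityMeasure μ] (h : HypP pp qq μ)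
    {G : (ι → ℝ) → ℝ} (hG : Continuous G) (h0 : ∀ x, 0 ≤ G x) (h1 : ∀ x, G x ≤ 1) :
    ∫ z, G (pp z) * G (qq z) ∂μ ≤ (∫ z, G (pp z) ∂μ) ^ (1/2:ℝ) * (∫ z, G (qq z) ∂μ) ^ (3/4:ℝ) := by
  have hp := pp_cont (ι := ι)
  have hq := qq_cont (ι := ι)
  have hh := h (fun x => ENNReal.ofReal (G x)) (fun x => ENNReal.ofReal (G x))
    (by fun_prop) (by fun_prop)
  have le1 : ∀ x, ENNReal.ofReal (G x) ≤ 1 := fun x => by simpa using h1 x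
  have k1 : ∫⁻ z, ENNReal.ofReal (G (pp z)) ^ (2:ℝ) ∂μ ≤ ∫⁻ z, ENNReal.ofReal (G (pp z)) ∂μ :=
    lintegral_mono fun z => by
      simpa using ENNReal.rpow_le_rpow_of_exponent_ge (le1 (pp z)) (show (1:ℝ) ≤ 2 by norm_num)
  have k2 : ∫⁻ z, ENNReal.ofReal (G (qq z)) ^ (4/3:ℝ) ∂μ ≤ ∫⁻ z, ENNReal.ofReal (G (qq z)) ∂μ :=
    lintegral_mono fun z => by
      simpa using ENNReal.rpow_le_rpow_of_exponent_ge (le1 (qq z)) (show (1:ℝ) ≤ 4/3 by norm_num)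
  have hh2 := hh.trans (mul_le_mul' (ENNReal.rpow_le_rpow k1 (by norm_num))
    (ENNReal.rpow_le_rpow k2 (by norm_num)))
  have bi : ∀ F : HH ι → ℝ, Continuous F → (∀ z, 0 ≤ F z) → (∀ z, F z ≤ 1) → Integrable F μ := by
    intro F hF f0 f1
    refine Integrable.of_bound hF.aestronglyMeasurable 1 (Eventually.of_forall fun z => ?_)
    rw [Real.norm_eq_abs, abs_of_nonneg (f0 z)]; exact f1 z
  have e1 := ofReal_integral_eq_lintegral_ofReal (bi (fun z => G (pp z)) (by fun_prop)
    (fun z => h0 _) (fun z => h1 _)) (Eventually.of_forall fun z => h0 _)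
  have e2 := ofReal_integral_eq_lintegral_ofReal (bi (fun z => G (qq z)) (by fun_prop)
    (fun z => h0 _) (fun z => h1 _)) (Eventually.of_forall fun z => h0 _)
  have e3 := ofReal_integral_eq_lintegral_ofReal (bi (fun z => G (pp z) * G (qq z)) (by fun_prop)
    (fun z => mul_nonneg (h0 _) (h0 _)) (fun z => mul_le_one₀ (h1 _) (h0 _) (h1 _)))
      (Eventually.of_forall fun z => mul_nonneg (h0 _) (h0 _))
  simp only [ENNReal.ofReal_mul (h0 _)] at e3
  rw [← e1, ← e2, ← e3] at hh2
  have i1 : 0 ≤ ∫ z, G (pp z) ∂μ := integral_nonneg fun z => h0 _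
  have i2 : 0 ≤ ∫ z, G (qq z) ∂μ := integral_nonneg fun z => h0 _
  rw [ENNReal.ofReal_rpow_of_nonneg i1 (by norm_num),
    ENNReal.ofReal_rpow_of_nonneg i2 (by norm_num), ← ENNReal.ofReal_mul (by positivity)] at hh2
  exact (ENNReal.ofReal_le_ofReal_iff (by positivity)).1 hh2

/-- Gaussian hypercontractivity in the form we need. -/
theorem gauss_hyp (γ : Measure (ι → ℝ)) [IsGaussian γ] (hγ : ∫ x, x ∂γ = 0)
    {G : (ι → ℝ) → ℝ} (hG : Continuous G) (h0 : ∀ x, 0 ≤ G x) (h1 : ∀ x, G x ≤ 1) :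
    ∫ z, G z.1 * G ((1/2:ℝ) • z.1 + (√3/2) • z.2) ∂(γ.prod γ) ≤ (∫ x, G x ∂γ) ^ (5/4:ℝ) := by
  obtain ⟨m, b, hb⟩ := cov_factor γ
  choose μ hμ1 hμ2 hμ3 using hyp_approx b
  let μs : ℕ → ProbabilityMeasure (HH ι) := fun N => ⟨μ N, hμ1 N⟩
  have hpr : IsProbabilityMeasure ((γ.prod γ).map (Lm : _ →L[ℝ] HH ι)) :=
    Measure.isProbabilityMeasure_map (by fun_prop)
  let μ0 : ProbabilityMeasure (HH ι) := ⟨(γ.prod γ).map Lm, hpr⟩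
  have hw : Tendsto μs atTop (𝓝 μ0) := by
    refine ProbabilityMeasure.tendsto_of_tendsto_charFun fun t => ?_
    simp only [μs, μ0, ProbabilityMeasure.coe_mk, Lm_charFun γ hγ hb, hμ3]
    exact hyp_lim b t
  rw [ProbabilityMeasure.tendsto_iff_forall_integral_tendsto] at hw
  have hp := pp_cont (ι := ι)
  have hq := qq_cont (ι := ι)
  have lim : ∀ F : HH ι → ℝ, Continuous F → (∀ z, 0 ≤ F z) → (∀ z, F z ≤ 1) →
      Tendsto (fun N => ∫ z, F z ∂(μ N)) atTop (𝓝 (∫ z, F (Lm z) ∂(γ.prod γ))) := by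
    intro F hF f0 f1
    have := hw (BoundedContinuousFunction.ofNormedAddCommGroup F hF 1 fun z => by
      rw [Real.norm_eq_abs, abs_of_nonneg (f0 z)]; exact f1 z)
    simp only [BoundedContinuousFunction.coe_ofNormedAddCommGroup, μs, μ0,
      ProbabilityMeasure.coe_mk] at this
    rwa [integral_map (by fun_prop) hF.aestronglyMeasurable] at this
  have l1 := lim (fun z => G (pp z)) (by fun_prop) (fun z => h0 _) (fun z => h1 _)
  have l2 := lim (fun z => G (qq z)) (by fun_prop) (fun z => h0 _) (fun z => h1 _)
  have l3 := lim (fun z => G (pp z) * G (qq z)) (by fun_prop)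
    (fun z => mul_nonneg (h0 _) (h0 _)) (fun z => mul_le_one₀ (h1 _) (h0 _) (h1 _))
  have key := le_of_tendsto_of_tendsto' l3 ((l1.rpow_const (p := 1/2) (Or.inr (by norm_num))).mul
    (l2.rpow_const (p := 3/4) (Or.inr (by norm_num)))) fun N =>
      @HypP.real _ _ (μ N) (hμ1 N) (hμ2 N) G hG h0 h1
  have hPG : PG G := PG.of_bdd (A := 1) hG.measurable fun z => by
    rw [abs_of_nonneg (h0 z)]; exact h1 z
  have ep : ∀ z : (ι → ℝ) × (ι → ℝ), pp (Lm z) = z.1 := fun z => rfl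
  have eq : ∀ z : (ι → ℝ) × (ι → ℝ), qq (Lm z) = (1/2:ℝ) • z.1 + (√3/2) • z.2 := fun z => rfl
  simp only [ep, eq] at key
  have hcs : (1/2:ℝ) ^ 2 + (√3/2) ^ 2 = 1 := by
    rw [div_pow (√3), Real.sq_sqrt (by norm_num)]; norm_num
  rw [map_pair γ hγ hcs hPG] at key
  have m1 : ∫ z : (ι → ℝ) × (ι → ℝ), G z.1 ∂(γ.prod γ) = ∫ x, G x ∂γ := by
    have hf : PG (fun z : (ι → ℝ) × (ι → ℝ) => G z.1) := hPG.fst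
    rw [integral_prod _ (hf.integrable _)]; simp
  rw [m1] at key
  refine key.trans_eq ?_
  rw [← Real.rpow_add_of_nonneg (integral_nonneg h0) (by norm_num) (by norm_num)]
  norm_num

end HypG

open MeasureTheory ProbabilityTheory Real

section ThmA
open Filter Topology

lemma logconvex_max {V : ℕ → ℝ} (h0 : ∀ k, 0 ≤ V k) (hV : ∀ k, V (k+1) ^ 2 ≤ V k * V (k+2))
    (hV0 : V 0 ≤ 1) {K : ℕ} (hK : V K ≤ 1) : ∀ k ≤ K, V k ≤ 1 := by
  have step : ∀ k, 1 < V k → V k ≤ V (k+1) := by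
    intro k
    induction k with
    | zero => intro h; linarith
    | succ k ih =>
      intro h
      have h1 : V k ≤ V (k+1) := by
        by_cases hk : 1 < V k
        · exact ih hk
        · linarith
      have h2 := hV k
      have h3 : V k * V (k+2) ≤ V (k+1) * V (k+2) := mul_le_mul_of_nonneg_right h1 (h0 _)
      have h4 : V (k+1) * V (k+1) ≤ V (k+1) * V (k+2) := by nlinarith
      exact le_of_mul_le_mul_left h4 (by linarith)
  intro k hk
  by_contra hc
  push Not at hc
  have : ∀ j, 1 < V (k + j) := by
    intro j
    induction j with
    | zero => exact hc
    | succ j ih => exact ih.trans_le (step _ ih)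
  have := this (K - k)
  rw [Nat.add_sub_cancel' hk] at this
  linarith

variable {ι : Type*} [Fintype ι] (γ : Measure (ι → ℝ)) [IsGaussian γ] (hγ : ∫ x, x ∂γ = 0)

include hγ in
lemma T_comp {c s c' s' s'' : ℝ} (h : c ^ 2 + s ^ 2 = 1) (h' : c' ^ 2 + s' ^ 2 = 1)
    (hs : 0 < s'') (h'' : (c * c') ^ 2 + s'' ^ 2 = 1) {u : (ι → ℝ) → ℝ} (hu : PG u) :
    T γ c s (T γ c' s' u) = T γ (c * c') s'' u := by
  ext x
  have hpg : PG (fun y => u ((c * c') • x + s'' • y)) := by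
    obtain ⟨mu, A, hA, k, hk⟩ := hu
    refine ⟨mu.comp (by fun_prop), A * ((1 + |c * c'| * ‖x‖) * (1 + |s''|)) ^ k, by positivity, k,
      fun y => ?_⟩
    refine (hk _).trans ?_
    rw [mul_assoc, ← mul_pow]
    gcongr
    have := norm_add_le ((c * c') • x) (s'' • y)
    rw [norm_smul, norm_smul, Real.norm_eq_abs, Real.norm_eq_abs] at this
    have h1 : 0 ≤ |c * c'| * ‖x‖ := by positivity
    have h2 : 0 ≤ |s''| * ‖y‖ := by positivity
    have h3 := norm_nonneg y
    have h4 := abs_nonneg s''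
    nlinarith [mul_nonneg h1 h2, mul_nonneg h1 h3, mul_nonneg h1 h4]
  have hq : (c' * s / s'') ^ 2 + (s' / s'') ^ 2 = 1 := by
    rw [div_pow, div_pow, ← add_div, div_eq_one_iff_eq (by positivity)]
    nlinarith
  have := map_pair γ hγ hq hpg
  simp only [T]
  rw [← this, integral_prod _ ((hpg.lc _ _).integrable _)]
  congr 1
  ext y
  congr 1
  ext w
  congr 1
  have e1 : s'' * (c' * s / s'') = c' * s := by field_simp
  have e2 : s'' * (s' / s'') = s' := by field_simp
  rw [smul_add, smul_add, smul_smul, smul_smul, smul_smul, smul_smul, e1, e2, mul_comm c' c, add_assoc]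

include hγ in
lemma T_iter {c s : ℝ} (hc0 : 0 < c) (hc1 : c < 1) (h : c ^ 2 + s ^ 2 = 1)
    {u : (ι → ℝ) → ℝ} (hu : PG u) (k : ℕ) :
    (T γ c s)^[k+1] u = T γ (c ^ (k+1)) (√(1 - (c ^ (k+1)) ^ 2)) u ∨ s < 0 := by
  by_cases hs : s < 0
  · exact Or.inr hs
  left
  have hlt : ∀ k : ℕ, 0 < 1 - (c ^ (k+1)) ^ 2 := by
    intro k
    have h1 : c ^ (k+1) < 1 := pow_lt_one₀ hc0.le hc1 (by omega)
    have h2 : 0 < c ^ (k+1) := by positivity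
    nlinarith
  induction k with
  | zero =>
    have : s = √(1 - c ^ 2) := by
      rw [← h]; simp [Real.sqrt_sq (not_lt.1 hs)]
    simp [← this]
  | succ k ih =>
    rw [Function.iterate_succ_apply', ih]
    rw [T_comp γ hγ h (s'' := √(1 - (c ^ (k+1+1)) ^ 2)) ?_ (Real.sqrt_pos.2 (hlt _)) ?_ hu]
    · rw [pow_succ' c (k+1)]
    · rw [Real.sq_sqrt (hlt _).le]; ring
    · rw [Real.sq_sqrt (hlt _).le]; ring

include hγ in
lemma iter_adj {c s : ℝ} (h : c ^ 2 + s ^ 2 = 1) (k : ℕ) {u v : (ι → ℝ) → ℝ} (hu : PG u)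
    (hv : PG v) :
    ∫ x, (T γ c s)^[k] u x * v x ∂γ = ∫ x, u x * (T γ c s)^[k] v x ∂γ := by
  induction k generalizing u v with
  | zero => rfl
  | succ k ih =>
    rw [Function.iterate_succ_apply, ih (hu.T γ c s) hv, ← T_adj γ hγ h hu (hv.iter γ c s k),
      Function.iterate_succ_apply']

include hγ in
lemma U_bound {c s Λ A R : ℝ} {K : ℕ} (hK : 0 < K) (hc0 : 0 < c) (hc1 : c < 1) (hs : 0 ≤ s)
    (h : c ^ 2 + s ^ 2 = 1) (hcK : c ^ (2 * K) = 1/2) (hR : 0 < R)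
    (hRK : R ^ K = exp (-(Λ/4)))
    {g : (ι → ℝ) → ℝ} (hg : Continuous g) (h0 : ∀ x, 0 ≤ g x) (h1 : ∀ x, g x ≤ 1)
    (hA : ∫ x, g x ∂γ = A) (hAΛ : A ≤ exp (-Λ)) (k : ℕ) :
    ∫ x, ((T γ c s)^[k] g x) ^ 2 ∂γ ≤ A * (R ^ k + exp (-(Λ/4))) := by
  have hPG : PG g := PG.of_bdd (A := 1) hg.measurable fun z => by
    rw [abs_of_nonneg (h0 z)]; exact h1 z
  set U : ℕ → ℝ := fun k => ∫ x, ((T γ c s)^[k] g x) ^ 2 ∂γ with hU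
  have hU0 : ∀ k, 0 ≤ U k := fun k => integral_nonneg fun x => sq_nonneg _
  have hA0 : 0 ≤ A := hA ▸ integral_nonneg h0
  have hUA : U 0 ≤ A := by
    rw [← hA]
    refine integral_mono (hPG.sq.integrable γ) (hPG.integrable γ) fun x => ?_
    simp only [Function.iterate_zero, id]
    nlinarith [h0 x, h1 x]
  have hUc : ∀ k, U (k+1) ≤ U k := by
    intro k
    simp only [hU, Function.iterate_succ_apply']
    exact T_contr γ hγ h (hPG.iter γ c s k)
  have hUm : Antitone U := antitone_nat_of_succ_le hUc
  have hUlog : ∀ k, U (k+1) ^ 2 ≤ U k * U (k+2) := by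
    intro k
    have p1 := hPG.iter γ c s k
    have p2 := hPG.iter γ c s (k+2)
    have := integral_cs γ (p1.sq.integrable γ) (p2.sq.integrable γ) ((p1.mul p2).integrable γ)
    refine le_trans (le_of_eq ?_) this
    congr 1
    rw [Function.iterate_succ_apply' (T γ c s) (k+1), T_adj γ hγ h p1 (hPG.iter γ c s (k+1))]
    simp only [hU, ← Function.iterate_succ_apply' (T γ c s) k, sq]
  have hUK : U K ≤ A * exp (-(Λ/4)) := by
    have e1 : U K = ∫ z, g z.1 * g ((1/2:ℝ) • z.1 + (√3/2) • z.2) ∂(γ.prod γ) := by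
      simp only [hU, sq]
      rw [iter_adj γ hγ h K hPG (hPG.iter γ c s K)]
      simp only [← Function.iterate_add_apply]
      obtain ⟨m, hm⟩ : ∃ m, K + K = m + 1 := ⟨K + K - 1, by omega⟩
      have h2 := (T_iter γ hγ hc0 hc1 h hPG m).resolve_right (not_lt.2 hs)
      rw [← hm, ← two_mul, hcK] at h2
      rw [← two_mul, h2, T_pair γ hPG hPG]
      have : √(1 - (1/2:ℝ) ^ 2) = √3/2 := by
        rw [show (1 - (1/2:ℝ) ^ 2) = 3 / 2 ^ 2 by norm_num, Real.sqrt_div (by norm_num),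
          Real.sqrt_sq (by norm_num)]
      rw [this]
    rw [e1]
    refine (gauss_hyp γ hγ hg h0 h1).trans ?_
    rw [hA, show (5/4:ℝ) = 1 + 1/4 by norm_num, Real.rpow_add_of_nonneg hA0 (by norm_num)
      (by norm_num), Real.rpow_one]
    refine mul_le_mul_of_nonneg_left ?_ hA0
    calc A ^ (1/4:ℝ) ≤ (exp (-Λ)) ^ (1/4:ℝ) := Real.rpow_le_rpow hA0 hAΛ (by norm_num)
      _ = _ := by rw [← Real.exp_mul]; congr 1; ring
  have hR0 : ∀ k, 0 < R ^ k := fun k => by positivity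
  rcases hA0.eq_or_lt with hz | hpos
  · have : U k ≤ U 0 := hUm (Nat.zero_le _)
    rw [← hz] at hUA ⊢
    simp only [zero_mul]
    exact this.trans hUA
  rcases le_total k K with hk | hk
  · have := logconvex_max (V := fun k => U k / (A * R ^ k)) (K := K)
      (fun k => div_nonneg (hU0 k) (by positivity)) ?_ ?_ ?_ k hk
    · rw [div_le_one (by positivity)] at this
      refine this.trans ?_
      gcongr
      linarith [exp_pos (-(Λ/4))]
    · intro k
      have e : (A * R ^ (k+1)) ^ 2 = A * R ^ k * (A * R ^ (k+2)) := by ring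
      rw [div_pow, div_mul_div_comm, e]
      exact div_le_div_of_nonneg_right (hUlog k) (by positivity)
    · simpa using (div_le_one hpos).2 hUA
    · rw [hRK, div_le_one (by positivity)]; exact hUK
  · have : U k ≤ U K := hUm hk
    refine (this.trans hUK).trans ?_
    gcongr
    linarith [hR0 k]

lemma W_bound {ε B : ℝ} {κ : Type*} [Fintype κ] [DecidableEq ι] (D : κ → Finset ι) {r : ℝ}
    {P : ι → (ι → ℝ) → ℝ} (hP : ∀ i, PG (P i)) (hP0 : ∀ i x, 0 ≤ P i x)
    (hP1 : ∀ x, ∑ i, P i x = 1)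
    (hcov : ∀ i j, ∫ x, x i * x j ∂γ ≤ ε + ∑ a, (if i ∈ D a ∧ j ∈ D a then (1:ℝ) else 0))
    (A : κ → ℝ) (hA : ∑ a, A a ≤ B) (hr : 0 ≤ r)
    (hU : ∀ a, ∫ x, (∑ i ∈ D a, P i x) ^ 2 ∂γ ≤ A a * r) :
    Wq γ P ≤ ε + B * r := by
  have hpt : ∀ x, ∑ i, ∑ j, (∫ y, y i * y j ∂γ) * (P i x * P j x) ≤
      ε + ∑ a, (∑ i ∈ D a, P i x) ^ 2 := by
    intro x
    calc _ ≤ ∑ i, ∑ j, (ε + ∑ a, (if i ∈ D a ∧ j ∈ D a then (1:ℝ) else 0)) * (P i x * P j x) := by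
          refine Finset.sum_le_sum fun i _ => Finset.sum_le_sum fun j _ => ?_
          exact mul_le_mul_of_nonneg_right (hcov i j) (mul_nonneg (hP0 i x) (hP0 j x))
      _ = ε * ((∑ i, P i x) * (∑ j, P j x)) + ∑ a, (∑ i ∈ D a, P i x) ^ 2 := by
          simp only [add_mul, Finset.sum_add_distrib]
          congr 1
          · rw [Finset.sum_mul_sum, Finset.mul_sum]
            exact Finset.sum_congr rfl fun i _ => by rw [Finset.mul_sum]
          · simp only [Finset.sum_mul]
            have e2 : ∀ i : ι, ∑ j, ∑ a, (if i ∈ D a ∧ j ∈ D a then (1:ℝ) else 0) * (P i x * P j x)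
              = ∑ a, ∑ j, (if i ∈ D a ∧ j ∈ D a then (1:ℝ) else 0) * (P i x * P j x) :=
              fun i => Finset.sum_comm
            simp only [e2]
            rw [Finset.sum_comm]
            refine Finset.sum_congr rfl fun a _ => ?_
            have e3 : ∑ i ∈ D a, P i x = ∑ i, if i ∈ D a then P i x else 0 := by
              rw [← Finset.sum_filter]; simp
            rw [sq, e3, Finset.sum_mul_sum]
            refine Finset.sum_congr rfl fun i _ => Finset.sum_congr rfl fun j _ => ?_
            by_cases hi : i ∈ D a <;> by_cases hj : j ∈ D a <;> simp [hi, hj]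
      _ = _ := by rw [hP1]; ring
  have hI1 : PG (fun x => ∑ i, ∑ j, (∫ y, y i * y j ∂γ) * (P i x * P j x)) :=
    PG.sum _ fun i _ => PG.sum _ fun j _ => PG.cmul _ ((hP i).mul (hP j))
  have hI2 : ∀ a, PG (fun x => (∑ i ∈ D a, P i x) ^ 2) := fun a =>
    (PG.sum _ fun i _ => hP i).sq
  calc Wq γ P ≤ ∫ x, (ε + ∑ a, (∑ i ∈ D a, P i x) ^ 2) ∂γ :=
        integral_mono (hI1.integrable γ)
          (((PG.const ε).add (PG.sum _ fun a _ => hI2 a)).integrable γ) hpt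
    _ = ε + ∑ a, ∫ x, (∑ i ∈ D a, P i x) ^ 2 ∂γ := by
        rw [integral_add (integrable_const _) ((PG.sum _ fun a _ => hI2 a).integrable γ),
          integral_finsetSum _ fun a _ => (hI2 a).integrable γ]
        simp
    _ ≤ ε + ∑ a, A a * r := by gcongr with a; exact hU a
    _ ≤ _ := by rw [← Finset.sum_mul]; gcongr

include hγ in
lemma thmA_K {κ : Type*} [Fintype κ] [DecidableEq ι] {f : (ι → ℝ) → ℝ} {p : ι → (ι → ℝ) → ℝ}
    (hf : PG f) (hpc : ∀ i, Continuous (p i)) (hp0 : ∀ i x, 0 ≤ p i x)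
    (hp1 : ∀ x, ∑ i, p i x = 1) (hS : SG f p 1) (D : κ → Finset ι) {ε Λ : ℝ} (hε : 0 ≤ ε)
    (hcov : ∀ i j, ∫ x, x i * x j ∂γ ≤ ε + ∑ a, (if i ∈ D a ∧ j ∈ D a then (1:ℝ) else 0))
    (hcnt : ∀ i, ∑ a, (if i ∈ D a then (1:ℝ) else 0) ≤ 2) (hΛ : 0 < Λ)
    (hA : ∀ a, ∫ x, ∑ i ∈ D a, p i x ∂γ ≤ exp (-Λ)) {K : ℕ} (hK : 0 < K) :
    ∫ x, f x ^ 2 ∂γ - (∫ x, f x ∂γ) ^ 2 ≤ (4 * Bn γ + 8) * (K:ℝ)⁻¹ + (4 * ε + 64 / Λ) := by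
  have hKr : (0:ℝ) < K := by exact_mod_cast hK
  have hple : ∀ i x, p i x ≤ 1 := fun i x =>
    (hp1 x) ▸ Finset.single_le_sum (fun j _ => hp0 j x) (Finset.mem_univ i)
  have hp : ∀ i, PG (p i) := fun i => PG.of_bdd (A := 1) (hpc i).measurable fun z => by
    rw [abs_of_nonneg (hp0 i z)]; exact hple i z
  have hB0 : 0 ≤ Bn γ := integral_nonneg fun x => Finset.sum_nonneg fun i _ => sq_nonneg _
  -- parameters
  set c : ℝ := exp (-(Real.log 2 / (2 * K))) with hc
  have hl2 : 0 < Real.log 2 := Real.log_pos (by norm_num)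
  have hl2' : Real.log 2 < 1 := by linarith [Real.log_two_lt_d9]
  have hc0 : 0 < c := exp_pos _
  have hc1 : c < 1 := by rw [hc, Real.exp_lt_one_iff]; simp; positivity
  have hc2 : 0 < 1 - c ^ 2 := by nlinarith
  set s : ℝ := √(1 - c ^ 2) with hs
  have hs0 : 0 ≤ s := Real.sqrt_nonneg _
  have hs2 : s ^ 2 = 1 - c ^ 2 := Real.sq_sqrt hc2.le
  have h : c ^ 2 + s ^ 2 = 1 := by rw [hs2]; ring
  have hcK : c ^ (2 * K) = 1/2 := by
    rw [hc, ← Real.exp_nat_mul]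
    have : ((2 * K : ℕ) : ℝ) * -(Real.log 2 / (2 * K)) = -Real.log 2 := by
      push_cast; field_simp
    rw [this, Real.exp_neg, Real.exp_log (by norm_num)]; norm_num
  have hs2K : s ^ 2 ≤ (K:ℝ)⁻¹ := by
    have h1 : c ^ 2 = exp (-(Real.log 2 / K)) := by
      rw [hc, ← Real.exp_nat_mul]; congr 1; push_cast; field_simp
    have h2 := Real.add_one_le_exp (-(Real.log 2 / K))
    rw [hs2, h1]
    have h3 : Real.log 2 / K ≤ (K:ℝ)⁻¹ := by
      rw [div_eq_mul_inv]; nlinarith [inv_pos.2 hKr]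
    linarith
  set R : ℝ := exp (-(Λ / (4 * K))) with hRdef
  have hR0 : 0 < R := exp_pos _
  have hR1 : R < 1 := by rw [hRdef, Real.exp_lt_one_iff]; simp; positivity
  have hRK : R ^ K = exp (-(Λ/4)) := by
    rw [hRdef, ← Real.exp_nat_mul]; congr 1; field_simp
  have hsR : s ^ 2 ≤ (4 / Λ + (K:ℝ)⁻¹) * (1 - R) := by
    have h1 : R * (1 + Λ / (4 * K)) ≤ 1 := by
      have := Real.add_one_le_exp (Λ / (4 * K))
      calc R * (1 + Λ / (4 * K)) ≤ R * exp (Λ / (4 * K)) := by gcongr; linarith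
        _ = 1 := by rw [hRdef, ← Real.exp_add]; simp
    have h2 : (4 / Λ + (K:ℝ)⁻¹) = (K:ℝ)⁻¹ * (4 * K / Λ) * (1 + Λ / (4 * K)) := by
      field_simp
    have h3 : 1 ≤ (4 * K / Λ) * (1 + Λ / (4 * K)) * (1 - R) := by
      have : (4 * K / Λ) * (1 + Λ / (4 * K)) * (1 - R) =
        (4 * K / Λ) * ((1 + Λ / (4 * K)) - R * (1 + Λ / (4 * K))) := by ring
      rw [this]
      calc (1:ℝ) = (4 * K / Λ) * ((1 + Λ / (4 * K)) - 1) := by field_simp; ring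
        _ ≤ _ := by gcongr
    rw [h2]
    calc s ^ 2 ≤ (K:ℝ)⁻¹ * 1 := by simpa using hs2K
      _ ≤ (K:ℝ)⁻¹ * ((4 * K / Λ) * (1 + Λ / (4 * K)) * (1 - R)) := by gcongr
      _ = _ := by ring
  have he : exp (-(Λ/4)) ≤ 4 / Λ := by
    have := Real.add_one_le_exp (Λ/4)
    rw [Real.exp_neg, inv_le_comm₀ (exp_pos _) (by positivity), inv_div]
    linarith
  set E := exp (-(Λ/4)) with hE
  have hE0 : 0 < E := exp_pos _
  -- bounds on W
  have hsum : ∑ a, ∫ x, ∑ i ∈ D a, p i x ∂γ ≤ 2 := by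
    have hpa : ∀ a, PG (fun x => ∑ i ∈ D a, p i x) := fun a => PG.sum _ fun i _ => hp i
    rw [← integral_finsetSum _ fun a _ => (hpa a).integrable γ]
    calc _ ≤ ∫ x, (2:ℝ) ∂γ := by
          refine integral_mono ((PG.sum _ fun a _ => hpa a).integrable γ) (integrable_const _) ?_
          intro x
          simp only
          have e3 : ∀ a, ∑ i ∈ D a, p i x = ∑ i, (if i ∈ D a then (1:ℝ) else 0) * p i x := by
            intro a
            simp only [ite_mul, one_mul, zero_mul]
            rw [← Finset.sum_filter]; simp
          simp only [e3]
          rw [Finset.sum_comm]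
          simp only [← Finset.sum_mul]
          calc _ ≤ ∑ i, 2 * p i x := Finset.sum_le_sum fun i _ =>
                mul_le_mul_of_nonneg_right (hcnt i) (hp0 i x)
            _ = 2 := by rw [← Finset.mul_sum, hp1]; ring
      _ = 2 := by simp
  have hW : ∀ k, Wq γ (fun i => (T γ c s)^[k] (p i)) ≤ ε + 2 * (R ^ k + E) := by
    intro k
    refine W_bound γ D (fun i => (hp i).iter γ c s k) (fun i x => iter_nonneg γ (hp0 i) c s k x)
      ?_ hcov (fun a => ∫ x, ∑ i ∈ D a, p i x ∂γ) hsum (by positivity) ?_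
    · intro x
      have := congrFun (iter_sum γ Finset.univ hp c s k) x
      rw [← this]
      simp only [hp1]
      rw [iter_one]
    · intro a
      have := U_bound γ hγ hK hc0 hc1 hs0 h hcK hR0 hRK (g := fun x => ∑ i ∈ D a, p i x)
        (by fun_prop) (fun x => Finset.sum_nonneg fun i _ => hp0 i x)
        (fun x => by
          rw [← hp1 x]
          exact Finset.sum_le_univ_sum_of_nonneg fun i => hp0 i x) rfl (hA a) k
      have e := iter_sum γ (D a) hp c s k
      rw [e] at this
      exact this
  -- sum
  have hc2lt : c ^ 2 < 1 := by linarith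
  have hck : ∀ k : ℕ, (c ^ k) ^ 2 = (c ^ 2) ^ k := fun k => by rw [← pow_mul, ← pow_mul, mul_comm]
  have hgeo : ∀ N : ℕ, (∑ k ∈ Finset.range N, (c ^ k) ^ 2) * (1 - c ^ 2) ≤ 1 := by
    intro N
    simp only [hck]
    have := geom_sum_mul (c ^ 2) N
    have h5 : 0 ≤ (c ^ 2) ^ N := by positivity
    linarith
  have hgeoR : ∀ N : ℕ, (∑ k ∈ Finset.range N, R ^ k) * (1 - R) ≤ 1 := by
    intro N
    have := geom_sum_mul R N
    have h5 : 0 ≤ R ^ N := by positivity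
    linarith
  have hN : ∀ N : ℕ, ∫ x, f x ^ 2 ∂γ - (∫ x, f x ∂γ) ^ 2 ≤ 8 * (c ^ 2) ^ N * Bn γ +
      ((4 * Bn γ + 8) * (K:ℝ)⁻¹ + (4 * ε + 64 / Λ)) := by
    intro N
    refine (var_sum_bound γ hγ h hf hp hp0 hp1 hS N).trans ?_
    rw [← hck]
    refine add_le_add le_rfl ?_
    have hterm : ∀ k, 4 * (c ^ k) ^ 2 * ((1 - c) ^ 2 * Bn γ +
        s ^ 2 * Wq γ (fun i => (T γ c s)^[k] (p i))) ≤
        4 * ((1 - c) ^ 2 * Bn γ + s ^ 2 * (ε + 2 * E)) * (c ^ k) ^ 2 + 8 * s ^ 2 * R ^ k := by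
      intro k
      have h1 := mul_le_mul_of_nonneg_left (hW k) (sq_nonneg s)
      have h2 : (c ^ k) ^ 2 ≤ 1 := by
        rw [hck]; exact pow_le_one₀ (sq_nonneg c) hc2lt.le
      have h3 : 0 ≤ s ^ 2 * R ^ k := by positivity
      calc _ ≤ 4 * (c ^ k) ^ 2 * ((1 - c) ^ 2 * Bn γ + s ^ 2 * (ε + 2 * (R ^ k + E))) := by gcongr
        _ = 4 * ((1 - c) ^ 2 * Bn γ + s ^ 2 * (ε + 2 * E)) * (c ^ k) ^ 2
            + 8 * (s ^ 2 * R ^ k) * (c ^ k) ^ 2 := by ring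
        _ ≤ _ := by nlinarith
    refine (Finset.sum_le_sum fun k _ => hterm k).trans ?_
    rw [Finset.sum_add_distrib, ← Finset.mul_sum, ← Finset.mul_sum]
    have g1 := hgeo N
    have g2 := hgeoR N
    have hS1 : 0 ≤ ∑ k ∈ Finset.range N, (c ^ k) ^ 2 :=
      Finset.sum_nonneg fun k _ => by positivity
    have hS2 : 0 ≤ ∑ k ∈ Finset.range N, R ^ k := Finset.sum_nonneg fun k _ => by positivity
    generalize ∑ k ∈ Finset.range N, (c ^ k) ^ 2 = S1 at *
    generalize ∑ k ∈ Finset.range N, R ^ k = S2 at *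
    have t1 : s ^ 2 * S1 ≤ 1 := by rw [hs2]; linarith
    have t2 : (1 - c) ^ 2 * S1 ≤ (K:ℝ)⁻¹ := by
      have a1 : (1 - c) ^ 2 ≤ s ^ 2 * s ^ 2 := by
        rw [hs2, ← sq]
        have : 1 - c ≤ 1 - c ^ 2 := by nlinarith
        have : 0 ≤ 1 - c := by linarith
        gcongr
      calc (1 - c) ^ 2 * S1 ≤ s ^ 2 * s ^ 2 * S1 := by gcongr
        _ = s ^ 2 * (s ^ 2 * S1) := by ring
        _ ≤ s ^ 2 * 1 := by gcongr
        _ ≤ _ := by simpa using hs2K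
    have t3 : s ^ 2 * S2 ≤ 4 / Λ + (K:ℝ)⁻¹ := by
      have a0 : 0 ≤ 4 / Λ + (K:ℝ)⁻¹ := by positivity
      calc s ^ 2 * S2 ≤ (4 / Λ + (K:ℝ)⁻¹) * (1 - R) * S2 := by gcongr
        _ = (4 / Λ + (K:ℝ)⁻¹) * (S2 * (1 - R)) := by ring
        _ ≤ (4 / Λ + (K:ℝ)⁻¹) * 1 := by gcongr
        _ = _ := by ring
    have t4 := mul_le_mul_of_nonneg_left t2 hB0
    have t5 : (ε + 2 * E) * (s ^ 2 * S1) ≤ (ε + 2 * (4 / Λ)) * 1 := by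
      apply mul_le_mul _ t1 (by positivity) (by positivity)
      linarith
    have e64 : 64 / Λ = 16 * (4 / Λ) := by ring
    rw [e64]
    nlinarith
  have hlim : Tendsto (fun N : ℕ => 8 * (c ^ 2) ^ N * Bn γ +
      ((4 * Bn γ + 8) * (K:ℝ)⁻¹ + (4 * ε + 64 / Λ))) atTop
      (𝓝 (8 * 0 * Bn γ + ((4 * Bn γ + 8) * (K:ℝ)⁻¹ + (4 * ε + 64 / Λ)))) :=
    (((tendsto_pow_atTop_nhds_zero_of_lt_one (sq_nonneg c) hc2lt).const_mul 8).mul_const _).add_const _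
  have := ge_of_tendsto' hlim hN
  simpa using this

include hγ in
theorem thmA {κ : Type*} [Fintype κ] [DecidableEq ι] {f : (ι → ℝ) → ℝ} {p : ι → (ι → ℝ) → ℝ}
    (hf : PG f) (hpc : ∀ i, Continuous (p i)) (hp0 : ∀ i x, 0 ≤ p i x)
    (hp1 : ∀ x, ∑ i, p i x = 1) (hS : SG f p 1) (D : κ → Finset ι) {ε Λ : ℝ} (hε : 0 ≤ ε)
    (hcov : ∀ i j, ∫ x, x i * x j ∂γ ≤ ε + ∑ a, (if i ∈ D a ∧ j ∈ D a then (1:ℝ) else 0))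
    (hcnt : ∀ i, ∑ a, (if i ∈ D a then (1:ℝ) else 0) ≤ 2) (hΛ : 0 < Λ)
    (hA : ∀ a, ∫ x, ∑ i ∈ D a, p i x ∂γ ≤ exp (-Λ)) :
    ∫ x, f x ^ 2 ∂γ - (∫ x, f x ∂γ) ^ 2 ≤ 4 * ε + 64 / Λ := by
  have hlim : Tendsto (fun K : ℕ => (4 * Bn γ + 8) * (K:ℝ)⁻¹ + (4 * ε + 64 / Λ)) atTop
      (𝓝 ((4 * Bn γ + 8) * 0 + (4 * ε + 64 / Λ))) :=
    ((tendsto_inv_atTop_nhds_zero_nat (𝕜 := ℝ)).const_mul _).add_const _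
  have := ge_of_tendsto hlim (b := ∫ x, f x ^ 2 ∂γ - (∫ x, f x ∂γ) ^ 2) (by
    filter_upwards [eventually_gt_atTop 0] with K hK
    exact thmA_K γ hγ hf hpc hp0 hp1 hS D hε hcov hcnt hΛ hA hK)
  simpa using this

end ThmA

open MeasureTheory ProbabilityTheory Real

section Softmax
variable {ι : Type*} [Fintype ι] [Nonempty ι]

noncomputable def smZ (β : ℝ) (x : ι → ℝ) : ℝ := ∑ i, exp (β * x i)
noncomputable def sm (β : ℝ) (x : ι → ℝ) : ℝ := log (smZ β x) / β
noncomputable def gw (β : ℝ) (i : ι) (x : ι → ℝ) : ℝ := exp (β * x i) / smZ β x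

lemma smZ_pos (β : ℝ) (x : ι → ℝ) : 0 < smZ β x :=
  Finset.sum_pos (fun i _ => exp_pos _) Finset.univ_nonempty

omit [Nonempty ι] in
lemma smZ_cont (β : ℝ) : Continuous (smZ β : (ι → ℝ) → ℝ) := by
  unfold smZ; fun_prop

lemma sm_cont (β : ℝ) : Continuous (sm β : (ι → ℝ) → ℝ) := by
  unfold sm
  exact ((smZ_cont β).log fun x => (smZ_pos β x).ne').div_const _

lemma gw_cont (β : ℝ) (i : ι) : Continuous (gw β i) := by
  unfold gw
  exact Continuous.div (by fun_prop) (smZ_cont β) fun x => (smZ_pos β x).ne'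

lemma gw_nonneg (β : ℝ) (i : ι) (x : ι → ℝ) : 0 ≤ gw β i x :=
  div_nonneg (exp_pos _).le (smZ_pos β x).le

lemma gw_sum (β : ℝ) (x : ι → ℝ) : ∑ i, gw β i x = 1 := by
  unfold gw
  rw [← Finset.sum_div]
  exact div_self (smZ_pos β x).ne'

lemma gw_le_one (β : ℝ) (i : ι) (x : ι → ℝ) : gw β i x ≤ 1 := by
  rw [← gw_sum β x]
  exact Finset.single_le_sum (f := fun i => gw β i x) (fun j _ => gw_nonneg β j x)
    (Finset.mem_univ i)

lemma gw_eq {β : ℝ} (hβ : 0 < β) (i : ι) (x : ι → ℝ) : gw β i x = exp (β * (x i - sm β x)) := by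
  have : β * (x i - sm β x) = β * x i - log (smZ β x) := by
    unfold sm; field_simp
  rw [this, exp_sub, exp_log (smZ_pos β x)]; rfl

lemma le_sm {β : ℝ} (hβ : 0 < β) (i : ι) (x : ι → ℝ) : x i ≤ sm β x := by
  unfold sm
  rw [le_div_iff₀ hβ, Real.le_log_iff_exp_le (smZ_pos β x), mul_comm]
  exact Finset.single_le_sum (f := fun i => exp (β * x i)) (fun j _ => (exp_pos _).le)
    (Finset.mem_univ i)

lemma sm_le {β : ℝ} (hβ : 0 < β) (x : ι → ℝ) {m : ℝ} (hm : ∀ i, x i ≤ m) :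
    sm β x ≤ m + log (Fintype.card ι) / β := by
  have h1 : smZ β x ≤ Fintype.card ι * exp (β * m) := by
    calc smZ β x ≤ ∑ i : ι, exp (β * m) := Finset.sum_le_sum fun i _ => by
          gcongr; exact hm i
      _ = _ := by simp
  have hc : (0:ℝ) < Fintype.card ι := by exact_mod_cast Fintype.card_pos
  have h2 := Real.log_le_log (smZ_pos β x) h1
  rw [Real.log_mul hc.ne' (exp_pos _).ne', Real.log_exp] at h2
  unfold sm
  rw [div_le_iff₀ hβ, add_mul, div_mul_cancel₀ _ hβ.ne']
  linarith

lemma sm_PG {β : ℝ} (hβ : 0 < β) : PG (sm β : (ι → ℝ) → ℝ) := by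
  have hc : (1:ℝ) ≤ Fintype.card ι := by exact_mod_cast Fintype.card_pos
  have hl : 0 ≤ log (Fintype.card ι) / β := div_nonneg (Real.log_nonneg hc) hβ.le
  refine ⟨(sm_cont β).measurable, 1 + log (Fintype.card ι) / β, by positivity, 1, fun x => ?_⟩
  have hx : ∀ i, |x i| ≤ ‖x‖ := fun i => norm_le_pi_norm x i
  have h1 := sm_le hβ x (m := ‖x‖) fun i => (le_abs_self _).trans (hx i)
  obtain ⟨i⟩ := ‹Nonempty ι›
  have h2 := le_sm hβ i x
  have h3 := (abs_le.1 (hx i)).1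
  have := norm_nonneg x
  rw [abs_le]
  constructor <;> nlinarith

lemma sm_SG {β : ℝ} (hβ : 0 < β) : SG (sm β : (ι → ℝ) → ℝ) (gw β) 1 := by
  intro x x'
  have hj := convexOn_exp.map_sum_le (t := Finset.univ) (w := fun i => gw β i x)
    (p := fun i => β * (x' i - x i)) (fun i _ => gw_nonneg β i x) (gw_sum β x) (by simp)
  simp only [smul_eq_mul] at hj
  have e : ∑ i, gw β i x * exp (β * (x' i - x i)) = smZ β x' / smZ β x := by
    rw [smZ, Finset.sum_div]
    refine Finset.sum_congr rfl fun i _ => ?_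
    rw [gw, div_mul_eq_mul_div, ← exp_add]; congr 2; ring
  rw [e, ← Real.le_log_iff_exp_le (div_pos (smZ_pos _ _) (smZ_pos _ _)),
    Real.log_div (smZ_pos _ _).ne' (smZ_pos _ _).ne'] at hj
  have e2 : ∑ i, gw β i x * (β * (x' i - x i)) = - (β * ∑ i, (x i - x' i) * gw β i x) := by
    rw [Finset.mul_sum, ← Finset.sum_neg_distrib]
    exact Finset.sum_congr rfl fun i _ => by ring
  rw [e2] at hj
  unfold sm
  rw [one_mul, ← sub_div, div_le_iff₀ hβ]
  linarith

/-- the max -/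
noncomputable def mx (x : ι → ℝ) : ℝ := ⨆ i, x i

lemma le_mx (x : ι → ℝ) (i : ι) : x i ≤ mx x := le_ciSup (Set.finite_range x).bddAbove i
lemma mx_le (x : ι → ℝ) {m : ℝ} (h : ∀ i, x i ≤ m) : mx x ≤ m := ciSup_le h

lemma mx_PG : PG (mx : (ι → ℝ) → ℝ) := by
  refine ⟨Measurable.iSup fun i => measurable_pi_apply i, 1, zero_le_one, 1, fun x => ?_⟩
  have hx : ∀ i, |x i| ≤ ‖x‖ := fun i => norm_le_pi_norm x i
  have h1 := mx_le x (m := ‖x‖) fun i => (le_abs_self _).trans (hx i)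
  obtain ⟨i⟩ := ‹Nonempty ι›
  have h2 := le_mx x i
  have h3 := (abs_le.1 (hx i)).1
  rw [abs_le]
  constructor <;> linarith

lemma var_mx_le (γ : Measure (ι → ℝ)) [IsGaussian γ] {β : ℝ} (hβ : 0 < β) :
    variance mx γ ≤ 2 * (∫ x, sm β x ^ 2 ∂γ - (∫ x, sm β x ∂γ) ^ 2) +
      2 * (log (Fintype.card ι) / β) ^ 2 := by
  have hI := (mx_PG (ι := ι)).integrable γ
  have hI2 := (mx_PG (ι := ι)).sq.integrable γ
  have hS := (sm_PG (ι := ι) hβ).integrable γ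
  have hS2 := (sm_PG (ι := ι) hβ).sq.integrable γ
  set m := ∫ x, sm β x ∂γ with hm
  have key : ∀ x : ι → ℝ, (mx x - m) ^ 2 ≤ 2 * (sm β x - m) ^ 2 +
      2 * (log (Fintype.card ι) / β) ^ 2 := by
    intro x
    have h1 : mx x ≤ sm β x := mx_le x fun i => le_sm hβ i x
    have h2 := sm_le hβ x (le_mx x)
    nlinarith [sq_nonneg ((mx x - sm β x) - (sm β x - m)),
      mul_nonneg (sub_nonneg.2 h1) (sub_nonneg.2 h1)]
  have h1 : variance mx γ ≤ ∫ x, (mx x - m) ^ 2 ∂γ := by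
    rw [variance_eq_sub ((memLp_two_iff_integrable_sq hI.aestronglyMeasurable).2 hI2)]
    have : ∫ x, (mx x - m) ^ 2 ∂γ = ∫ x, mx x ^ 2 ∂γ - 2 * m * ∫ x, mx x ∂γ + m ^ 2 := by
      have e : ∀ x : ι → ℝ, (mx x - m) ^ 2 = mx x ^ 2 - 2 * m * mx x + m ^ 2 := fun x => by ring
      simp only [e]
      rw [integral_add ((mx_PG.sq.sub (mx_PG.cmul (2 * m))).integrable γ) (integrable_const _),
        integral_sub hI2 (hI.const_mul _), integral_const_mul]
      simp
    rw [this]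
    simp only [Pi.pow_apply]
    nlinarith [sq_nonneg (∫ x, mx x ∂γ - m)]
  refine h1.trans ?_
  have hq : PG (fun x : ι → ℝ => 2 * (sm β x - m) ^ 2 + 2 * (log (Fintype.card ι) / β) ^ 2) :=
    (((sm_PG hβ).sub (PG.const m)).sq.cmul 2).add (PG.const _)
  have hq' : PG (fun x : ι → ℝ => (mx x - m) ^ 2) := (mx_PG.sub (PG.const m)).sq
  refine (integral_mono (hq'.integrable γ) (hq.integrable γ) key).trans (le_of_eq ?_)
  have e : ∀ x : ι → ℝ, 2 * (sm β x - m) ^ 2 + 2 * (log (Fintype.card ι) / β) ^ 2 =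
    2 * sm β x ^ 2 - 4 * m * sm β x + (2 * m ^ 2 + 2 * (log (Fintype.card ι) / β) ^ 2) :=
    fun x => by ring
  simp only [e]
  rw [integral_add ((((sm_PG hβ).sq.cmul 2).sub ((sm_PG hβ).cmul (4 * m))).integrable γ)
      (integrable_const _),
    integral_sub (hS2.const_mul _) (hS.const_mul _), integral_const_mul, integral_const_mul]
  simp only [integral_const, probReal_univ, one_smul, ← hm]
  ring

end Softmax

open MeasureTheory ProbabilityTheory Real

section Conc
variable {ι : Type*} [Fintype ι] (γ : Measure (ι → ℝ)) [IsGaussian γ] (hγ : ∫ x, x ∂γ = 0)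

include hγ in
lemma lin_law (a : ι → ℝ) : γ.map (fun x => ∑ i, x i * a i) =
    gaussianReal 0 (∫ x, (∑ i, x i * a i) ^ 2 ∂γ).toNNReal := by
  let L : StrongDual ℝ (ι → ℝ) :=
    ∑ i, a i • ContinuousLinearMap.proj (R := ℝ) (φ := fun _ : ι => ℝ) i
  have hL : ∀ x, L x = ∑ i, x i * a i := fun x => by
    simp [L, ContinuousLinearMap.sum_apply, mul_comm]
  have h0 : γ[L] = 0 := by
    rw [IsGaussian.integral_dual, hγ, map_zero]
  have h := IsGaussian.map_eq_gaussianReal (μ := γ) L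
  rw [h0, variance_of_integral_eq_zero (by fun_prop) h0] at h
  have e : (L : (ι → ℝ) → ℝ) = fun x => ∑ i, x i * a i := funext hL
  rw [e] at h
  exact h

include hγ in
lemma lin_int (a : ι → ℝ) (t : ℝ) : Integrable (fun x => exp (t * ∑ i, x i * a i)) γ := by
  have h := integrable_exp_mul_gaussianReal (μ := 0)
    (v := (∫ x, (∑ i, x i * a i) ^ 2 ∂γ).toNNReal) t
  rw [← lin_law γ hγ a] at h
  exact h.comp_measurable (f := fun x : ι → ℝ => ∑ i, x i * a i) (by fun_prop)

include hγ in
lemma lin_mgf (a : ι → ℝ) (t : ℝ) : mgf (fun x => ∑ i, x i * a i) γ t =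
    exp ((∫ x, (∑ i, x i * a i) ^ 2 ∂γ) * t ^ 2 / 2) := by
  rw [mgf_gaussianReal (lin_law γ hγ a)]
  rw [Real.coe_toNNReal _ (integral_nonneg fun x => sq_nonneg _)]
  simp

include hγ in
lemma lin_lint (a : ι → ℝ) (t : ℝ) {V : ℝ} (hV : ∫ x, (∑ i, x i * a i) ^ 2 ∂γ ≤ V) :
    ∫⁻ x, ENNReal.ofReal (exp (t * ∑ i, x i * a i)) ∂γ ≤ ENNReal.ofReal (exp (V * t ^ 2 / 2)) := by
  rw [← ofReal_integral_eq_lintegral_ofReal (lin_int γ hγ a t)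
    (Filter.Eventually.of_forall fun x => (exp_pos _).le)]
  apply ENNReal.ofReal_le_ofReal
  have := lin_mgf γ hγ a t
  rw [mgf] at this
  rw [this]
  gcongr

include hγ in
lemma lin_tail (a : ι → ℝ) {V s : ℝ} (hV0 : 0 < V) (hs : 0 ≤ s)
    (hV : ∫ x, (∑ i, x i * a i) ^ 2 ∂γ ≤ V) :
    γ.real {x | s ≤ ∑ i, x i * a i} ≤ exp (-s ^ 2 / (2 * V)) := by
  refine (measure_ge_le_exp_mul_mgf (t := s / V) s (by positivity) (lin_int γ hγ a _)).trans ?_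
  rw [lin_mgf γ hγ, ← exp_add]
  apply exp_le_exp.2
  have h1 : (∫ x, (∑ i, x i * a i) ^ 2 ∂γ) * (s / V) ^ 2 / 2 ≤ V * (s / V) ^ 2 / 2 := by gcongr
  have e : -(s / V) * s + V * (s / V) ^ 2 / 2 = -s ^ 2 / (2 * V) := by
    field_simp; ring
  linarith

lemma single_sum [DecidableEq ι] (i : ι) (x : ι → ℝ) :
    ∑ j, x j * (Pi.single i (1:ℝ) : ι → ℝ) j = x i := by
  simp [Pi.single_apply]

include hγ in
lemma coord_tail (i : ι) {s : ℝ} (hs : 0 ≤ s) (hV : ∫ x, x i ^ 2 ∂γ ≤ 1) :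
    γ.real {x | s ≤ x i} ≤ exp (-s ^ 2 / 2) := by
  classical
  have := lin_tail γ hγ (Pi.single i 1) (V := 1) one_pos hs (by simpa only [single_sum] using hV)
  simpa only [single_sum, mul_one] using this

include hγ in
lemma coord_lower (i : ι) {t : ℝ} (ht : 0 ≤ t) (hV : ∫ x, x i ^ 2 ∂γ = 1) :
    exp (-(t+1) ^ 2 / 2) / 3 ≤ γ.real {x | t ≤ x i} := by
  classical
  have h := lin_law γ hγ (Pi.single i 1)
  simp only [single_sum, hV, Real.toNNReal_one] at h
  have e : γ {x | t ≤ x i} = gaussianReal 0 1 (Set.Ici t) := by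
    rw [← h, Measure.map_apply (by fun_prop) measurableSet_Ici]; rfl
  rw [Measure.real, e]
  apply (ENNReal.ofReal_le_iff_le_toReal (measure_ne_top _ _)).1
  rw [gaussianReal_apply 0 one_ne_zero]
  calc ENNReal.ofReal (exp (-(t+1) ^ 2 / 2) / 3)
      = ∫⁻ x in Set.Icc t (t+1), ENNReal.ofReal (exp (-(t+1) ^ 2 / 2) / 3) := by simp
    _ ≤ ∫⁻ x in Set.Icc t (t+1), gaussianPDF 0 1 x := by
        refine setLIntegral_mono (measurable_gaussianPDF 0 1) fun x hx => ?_
        apply ENNReal.ofReal_le_ofReal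
        rw [gaussianPDFReal, div_eq_inv_mul]
        have h3 : √(2 * π * ((1:NNReal):ℝ)) ≤ 3 := by
          rw [Real.sqrt_le_left (by norm_num)]
          have := Real.pi_lt_d2
          norm_num; linarith
        have h4 : 0 < √(2 * π * ((1:NNReal):ℝ)) := by
          have := Real.pi_pos
          norm_num; positivity
        have h5 : exp (-(t+1) ^ 2 / 2) ≤ exp (-(x - 0) ^ 2 / (2 * ((1:NNReal):ℝ))) := by
          apply exp_le_exp.2
          norm_num
          have := hx.1; have := hx.2
          nlinarith
        exact mul_le_mul (inv_anti₀ h4 h3) h5 (exp_pos _).le (by positivity)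
    _ ≤ _ := lintegral_mono_set fun x hx => hx.1

/-- The variance of a convex combination is at most one. -/
lemma wvar_le (hv : ∀ i j, ∫ x, x i * x j ∂γ ≤ 1) {a : ι → ℝ} (h0 : ∀ i, 0 ≤ a i)
    (h1 : ∑ i, a i = 1) : ∫ x, (∑ i, x i * a i) ^ 2 ∂γ ≤ 1 := by
  have hI : ∀ i j, Integrable (fun y : ι → ℝ => (a i * a j) * (y i * y j)) γ := fun i j =>
      (((PG.coord i).mul (PG.coord j)).cmul _).integrable γ
  have e : ∀ y : ι → ℝ, (∑ i, y i * a i) ^ 2 = ∑ i, ∑ j, (a i * a j) * (y i * y j) := by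
    intro y
    rw [sq, Finset.sum_mul_sum]
    exact Finset.sum_congr rfl fun i _ => Finset.sum_congr rfl fun j _ => by ring
  simp only [e]
  rw [integral_finsetSum _ fun i _ => integrable_finsetSum _ fun j _ => hI i j]
  calc _ ≤ ∑ i, ∑ j, a i * a j := by
        refine Finset.sum_le_sum fun i _ => ?_
        rw [integral_finsetSum _ fun j _ => hI i j]
        refine Finset.sum_le_sum fun j _ => ?_
        rw [integral_const_mul]
        exact mul_le_of_le_one_right (mul_nonneg (h0 i) (h0 j)) (hv i j)
    _ = 1 := by rw [← Finset.sum_mul_sum, h1, one_mul]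

include hγ in
lemma conc1 {f : (ι → ℝ) → ℝ} (hf : Measurable f) {N : ℕ} (hN : 0 < N) (l : ℝ) :
    ∫⁻ z, ENNReal.ofReal (exp (l * (f z.1 - f z.2))) ∂(γ.prod γ) ≤
    ∫⁻ z, ENNReal.ofReal (exp (l * N * (f z.1 - f (cos (π / (2 * N)) • z.1 +
      sin (π / (2 * N)) • z.2)))) ∂(γ.prod γ) := by
  have hN' : (0:ℝ) < N := by exact_mod_cast hN
  set η := π / (2 * N) with hη
  let w : ℕ → (ι → ℝ) × (ι → ℝ) → (ι → ℝ) := fun k z => cos (k * η) • z.1 + sin (k * η) • z.2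
  have hw0 : ∀ z, w 0 z = z.1 := fun z => by simp [w]
  have hwN : ∀ z, w N z = z.2 := fun z => by
    have : N * η = π / 2 := by rw [hη]; field_simp
    simp [w, this]
  have hwm : ∀ k, Measurable (w k) := fun k => by fun_prop
  have pt : ∀ z, ENNReal.ofReal (exp (l * (f z.1 - f z.2))) ≤
      ∑ k ∈ Finset.range N, ENNReal.ofReal (1 / N) *
        ENNReal.ofReal (exp (l * N * (f (w k z) - f (w (k+1) z)))) := by
    intro z
    have hs : ∑ k ∈ Finset.range N, (f (w k z) - f (w (k+1) z)) = f z.1 - f z.2 := by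
      rw [Finset.sum_range_sub', hw0, hwN]
    have hj := convexOn_exp.map_sum_le (t := Finset.range N) (w := fun _ => (1:ℝ) / N)
      (p := fun k => l * N * (f (w k z) - f (w (k+1) z))) (fun i _ => by positivity)
      (by simp; field_simp) (by simp)
    simp only [smul_eq_mul] at hj
    have e : ∑ k ∈ Finset.range N, (1:ℝ) / N * (l * N * (f (w k z) - f (w (k+1) z))) =
        l * (f z.1 - f z.2) := by
      rw [← hs, Finset.mul_sum]
      refine Finset.sum_congr rfl fun k _ => ?_
      field_simp
    rw [e] at hj
    refine (ENNReal.ofReal_le_ofReal hj).trans ?_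
    rw [ENNReal.ofReal_sum_of_nonneg fun i _ => by positivity]
    refine Finset.sum_le_sum fun k _ => ?_
    rw [ENNReal.ofReal_mul (by positivity)]
  refine (lintegral_mono pt).trans ?_
  have hm : ∀ k, Measurable fun z => ENNReal.ofReal (exp (l * N * (f (w k z) - f (w (k+1) z)))) :=
    fun k => by
      have h1 := hf.comp (hwm k)
      have h2 := hf.comp (hwm (k+1))
      exact ((((h1.sub h2).const_mul _).exp)).ennreal_ofReal
  rw [lintegral_finsetSum _ fun k _ => (hm k).const_mul _]
  have hk : ∀ k ∈ Finset.range N, ∫⁻ z, ENNReal.ofReal (1 / N) *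
        ENNReal.ofReal (exp (l * N * (f (w k z) - f (w (k+1) z)))) ∂(γ.prod γ) =
      ENNReal.ofReal (1 / N) * ∫⁻ z, ENNReal.ofReal (exp (l * N * (f z.1 - f (cos η • z.1 +
      sin η • z.2)))) ∂(γ.prod γ) := by
    intro k _
    rw [lintegral_const_mul _ (hm k)]
    congr 1
    conv_rhs => rw [← IsGaussian.map_rotation_eq_self (μ := γ) hγ (k * η)]
    rw [lintegral_map _ (by fun_prop)]
    · congr 1
      ext z
      congr 5
      · simp [w, ContinuousLinearMap.rotation_apply, add_mul, cos_add, sin_add]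
        ext i
        simp
        ring
    · have h2 : Measurable fun z : (ι → ℝ) × (ι → ℝ) => f (cos η • z.1 + sin η • z.2) :=
        hf.comp (by fun_prop)
      exact (((((hf.comp measurable_fst).sub h2).const_mul _).exp)).ennreal_ofReal
  rw [Finset.sum_congr rfl hk, Finset.sum_const, Finset.card_range, nsmul_eq_mul, ← mul_assoc]
  have : (N:ENNReal) * ENNReal.ofReal (1 / N) = 1 := by
    rw [← ENNReal.ofReal_natCast, ← ENNReal.ofReal_mul hN'.le]
    simp [hN'.ne']
  rw [this, one_mul]

include hγ in
lemma conc2 {f : (ι → ℝ) → ℝ} {p : ι → (ι → ℝ) → ℝ} (hf : Measurable f)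
    (hpc : ∀ i, Continuous (p i)) (hp0 : ∀ i x, 0 ≤ p i x)
    (hp1 : ∀ x, ∑ i, p i x = 1) (hS : SG f p 1) (hv : ∀ i j, ∫ x, x i * x j ∂γ ≤ 1)
    {l c s : ℝ} (hl : 0 ≤ l) :
    ∫⁻ z, ENNReal.ofReal (exp (l * (f z.1 - f (c • z.1 + s • z.2)))) ∂(γ.prod γ) ≤
    ENNReal.ofReal (exp ((l * s) ^ 2 / 2)) *
      ∫⁻ x, ENNReal.ofReal (exp (l * (1 - c) * ∑ i, x i * p i x)) ∂γ := by
  have h2 : Measurable fun z : (ι → ℝ) × (ι → ℝ) => f (c • z.1 + s • z.2) :=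
        hf.comp (by fun_prop)
  have h3 : Measurable fun z : (ι → ℝ) × (ι → ℝ) =>
      ENNReal.ofReal (exp (l * (f z.1 - f (c • z.1 + s • z.2)))) :=
    (((((hf.comp measurable_fst).sub h2).const_mul l).exp)).ennreal_ofReal
  rw [lintegral_prod _ h3.aemeasurable]
  have hpm : Measurable fun x : ι → ℝ => ∑ i, x i * p i x :=
    (by fun_prop : Continuous fun x : ι → ℝ => ∑ i, x i * p i x).measurable
  rw [← lintegral_const_mul _ ((hpm.const_mul _).exp).ennreal_ofReal]
  refine lintegral_mono fun x => ?_
  have pt : ∀ y, ENNReal.ofReal (exp (l * (f x - f (c • x + s • y)))) ≤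
      ENNReal.ofReal (exp (l * (1 - c) * ∑ i, x i * p i x)) *
        ENNReal.ofReal (exp ((-(l * s)) * ∑ i, y i * p i x)) := by
    intro y
    rw [← ENNReal.ofReal_mul (exp_pos _).le, ← exp_add]
    apply ENNReal.ofReal_le_ofReal
    apply exp_le_exp.2
    have h := mul_le_mul_of_nonneg_left (hS x (c • x + s • y)) hl
    refine h.trans (le_of_eq ?_)
    simp only [Finset.mul_sum, ← Finset.sum_add_distrib]
    refine Finset.sum_congr rfl fun i _ => ?_
    simp
    ring
  refine (lintegral_mono pt).trans ?_
  rw [lintegral_const_mul _ (by fun_prop), mul_comm]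
  gcongr
  have := lin_lint γ hγ (fun i => p i x) (-(l * s)) (wvar_le γ hv (fun i => hp0 i x) (hp1 x))
  refine this.trans (le_of_eq ?_)
  congr 2; ring

include hγ in
lemma conc3 {p : ι → (ι → ℝ) → ℝ} (hp0 : ∀ i x, 0 ≤ p i x)
    (hp1 : ∀ x, ∑ i, p i x = 1) (hv : ∀ i, ∫ x, x i ^ 2 ∂γ ≤ 1)
    {b K a : ℝ} (hK : 1 ≤ K) :
    ∫⁻ x, ENNReal.ofReal (exp (b * ∑ i, x i * p i x)) ∂γ ≤
      ENNReal.ofReal (exp a + Fintype.card ι * (exp ((K * b) ^ 2 / 2 - (K - 1) * a))) := by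
  classical
  have pt : ∀ x : ι → ℝ, ENNReal.ofReal (exp (b * ∑ i, x i * p i x)) ≤ ENNReal.ofReal (exp a) +
      ENNReal.ofReal (exp (-((K-1) * a))) * ∑ i, ENNReal.ofReal (exp (K * b * x i)) := by
    intro x
    rw [← ENNReal.ofReal_sum_of_nonneg fun i _ => (exp_pos _).le,
      ← ENNReal.ofReal_mul (exp_pos _).le, ← ENNReal.ofReal_add (exp_pos _).le (by positivity)]
    apply ENNReal.ofReal_le_ofReal
    rcases le_total (b * ∑ i, x i * p i x) a with h | h
    · have : 0 ≤ rexp (-((K - 1) * a)) * ∑ i, rexp (K * b * x i) := by positivity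
      linarith [exp_le_exp.2 h]
    · have h1 : b * ∑ i, x i * p i x ≤ -((K-1) * a) + K * (b * ∑ i, x i * p i x) := by
        nlinarith
      have h2 := exp_le_exp.2 h1
      rw [exp_add] at h2
      have hj := convexOn_exp.map_sum_le (t := Finset.univ) (w := fun i => p i x)
        (p := fun i => K * b * x i) (fun i _ => hp0 i x) (hp1 x) (by simp)
      simp only [smul_eq_mul] at hj
      have e : ∑ i, p i x * (K * b * x i) = K * (b * ∑ i, x i * p i x) := by
        simp only [Finset.mul_sum]
        exact Finset.sum_congr rfl fun i _ => by ring
      rw [e] at hj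
      have h3 : ∑ i, p i x * exp (K * b * x i) ≤ ∑ i, exp (K * b * x i) := by
        refine Finset.sum_le_sum fun i _ => mul_le_of_le_one_left (exp_pos _).le ?_
        rw [← hp1 x]
        exact Finset.single_le_sum (f := fun i => p i x) (fun j _ => hp0 j x) (Finset.mem_univ i)
      have h4 := mul_le_mul_of_nonneg_left (hj.trans h3) (exp_pos (-((K-1) * a))).le
      linarith [exp_pos a]
  refine (lintegral_mono pt).trans ?_
  rw [lintegral_add_left measurable_const, lintegral_const_mul _ (by fun_prop),
    lintegral_finsetSum _ (fun i _ => by fun_prop), lintegral_const, measure_univ, mul_one,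
    ENNReal.ofReal_add (exp_pos _).le (by positivity)]
  gcongr
  have h1 : ∀ i ∈ (Finset.univ : Finset ι), ∫⁻ x, ENNReal.ofReal (exp (K * b * x i)) ∂γ ≤
      ENNReal.ofReal (exp ((K * b) ^ 2 / 2)) := fun i _ => by
    have := lin_lint γ hγ (Pi.single i 1) (K * b) (V := 1) (by simpa only [single_sum] using hv i)
    simpa only [single_sum, one_mul] using this
  calc _ ≤ ENNReal.ofReal (exp (-((K-1) * a))) *
        ∑ i : ι, ENNReal.ofReal (exp ((K * b) ^ 2 / 2)) := by
        gcongr with i hi; exact h1 i hi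
    _ = _ := by
      rw [Finset.sum_const, nsmul_eq_mul, Finset.card_univ, ENNReal.ofReal_mul (by positivity),
        ENNReal.ofReal_natCast, mul_left_comm, ← ENNReal.ofReal_mul (exp_pos _).le, ← exp_add]
      congr 3; ring_nf

include hγ in
lemma conc {f : (ι → ℝ) → ℝ} {p : ι → (ι → ℝ) → ℝ} (hf : Measurable f)
    (hpc : ∀ i, Continuous (p i)) (hp0 : ∀ i x, 0 ≤ p i x)
    (hp1 : ∀ x, ∑ i, p i x = 1) (hS : SG f p 1) (hv : ∀ i j, ∫ x, x i * x j ∂γ ≤ 1)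
    {l K a t u : ℝ} (hl : 0 ≤ l) {N : ℕ} (hN : 0 < N) (hK : 1 ≤ K) :
    γ.real {x | t ≤ f x} * γ.real {x | f x < t - u} ≤
      exp (-(l * u)) * exp ((l * N * sin (π / (2 * N))) ^ 2 / 2) * (exp a + Fintype.card ι *
        exp ((K * (l * N * (1 - cos (π / (2 * N))))) ^ 2 / 2 - (K - 1) * a)) := by
  have h1 := conc1 γ hγ hf hN l
  have h2 := h1.trans (conc2 γ hγ hf hpc hp0 hp1 hS hv (by positivity))
  have h3 := h2.trans (mul_le_mul_right
    (conc3 γ hγ hp0 hp1 (fun i => by simpa only [sq] using hv i i) (a := a) hK) _)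
  have hA : MeasurableSet {x | t ≤ f x} := measurableSet_le measurable_const hf
  have hB : MeasurableSet {x | f x < t - u} := measurableSet_lt hf measurable_const
  have h4 : ENNReal.ofReal (exp (l * u)) * (γ {x | t ≤ f x} * γ {x | f x < t - u}) ≤
      ∫⁻ z, ENNReal.ofReal (exp (l * (f z.1 - f z.2))) ∂(γ.prod γ) := by
    rw [← Measure.prod_prod, ← lintegral_indicator_const (hA.prod hB)]
    refine lintegral_mono fun z => ?_
    refine Set.indicator_le' (f := fun _ => ENNReal.ofReal (exp (l * u)))
      (g := fun z : (ι → ℝ) × (ι → ℝ) => ENNReal.ofReal (exp (l * (f z.1 - f z.2))))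
      (fun z hz => ?_) (fun _ _ => zero_le) z
    apply ENNReal.ofReal_le_ofReal
    apply exp_le_exp.2
    have e1 : t ≤ f z.1 := hz.1
    have e2 : f z.2 < t - u := hz.2
    gcongr; linarith
  have h5 := ENNReal.toReal_mono (by finiteness) (h4.trans h3)
  rw [ENNReal.toReal_mul, ENNReal.toReal_mul, ENNReal.toReal_mul,
    ENNReal.toReal_ofReal (exp_pos _).le, ENNReal.toReal_ofReal (exp_pos _).le,
    ENNReal.toReal_ofReal (by positivity)] at h5
  rw [mul_assoc, exp_neg, ← div_eq_inv_mul, le_div_iff₀ (exp_pos _), mul_comm]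
  exact h5

end Conc

open MeasureTheory ProbabilityTheory Real

section Tail
variable {ι : Type*} [Fintype ι] (γ : Measure (ι → ℝ)) [IsGaussian γ] (hγ : ∫ x, x ∂γ = 0)

include hγ in
lemma pair_tail {i j : ι} (hi : ∫ x, x i ^ 2 ∂γ = 1) (hj : ∫ x, x j ^ 2 ∂γ = 1) {δ t : ℝ}
    (hδ : 0 ≤ δ) (ht : 0 ≤ t) (hij : ∫ x, x i * x j ∂γ ≤ δ) :
    γ.real {x | t ≤ x i ∧ t ≤ x j} ≤ exp (-t ^ 2 / (1 + δ)) := by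
  classical
  have e : ∀ x : ι → ℝ, ∑ k, x k * ((Pi.single i (1:ℝ) : ι → ℝ) k + (Pi.single j (1:ℝ) : ι → ℝ) k)
      = x i + x j := by
    intro x
    simp only [mul_add, Finset.sum_add_distrib, single_sum]
  have hV : ∫ x, (x i + x j) ^ 2 ∂γ ≤ 2 * (1 + δ) := by
    have e2 : ∀ x : ι → ℝ, (x i + x j) ^ 2 = x i ^ 2 + (2 * (x i * x j) + x j ^ 2) := fun x => by
      ring
    simp only [e2]
    have p1 : PG (fun x : ι → ℝ => x i ^ 2) := (PG.coord i).sq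
    have p2 : PG (fun x : ι → ℝ => x j ^ 2) := (PG.coord j).sq
    have p3 : PG (fun x : ι → ℝ => 2 * (x i * x j)) := ((PG.coord i).mul (PG.coord j)).cmul 2
    rw [integral_add (p1.integrable γ) ((p3.add p2).integrable γ),
      integral_add (p3.integrable γ) (p2.integrable γ), integral_const_mul, hi, hj]
    linarith
  have h := lin_tail γ hγ (fun k => (Pi.single i (1:ℝ) : ι → ℝ) k + (Pi.single j (1:ℝ) : ι → ℝ) k)
    (V := 2 * (1 + δ)) (s := 2 * t) (by positivity) (by positivity) (by simpa only [e] using hV)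
  simp only [e] at h
  have e3 : -(2 * t) ^ 2 / (2 * (2 * (1 + δ))) = -t ^ 2 / (1 + δ) := by
    field_simp
  rw [e3] at h
  refine le_trans (measureReal_mono ?_) h
  rintro x ⟨h1, h2⟩
  simp only [Set.mem_ofPred_eq]; linarith

include hγ in
lemma second_moment {f : (ι → ℝ) → ℝ} (hf : Measurable f) (hfx : ∀ i x, x i ≤ f x)
    (hv : ∀ i, ∫ x, x i ^ 2 ∂γ = 1) (J : Finset ι) {δ t : ℝ} (hδ : 0 ≤ δ) (ht : 0 ≤ t)
    (hJ : ∀ i ∈ J, ∀ j ∈ J, i ≠ j → ∫ x, x i * x j ∂γ ≤ δ) (hJ0 : 0 < J.card) :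
    J.card * (exp (-(t+1) ^ 2 / 2) / 3) ^ 2 ≤
      (exp (-(t+1) ^ 2 / 2) / 3 + J.card * exp (-t ^ 2 / (1 + δ))) * γ.real {x | t ≤ f x} := by
  classical
  let A : ι → Set (ι → ℝ) := fun i => {x | t ≤ x i}
  have hA : ∀ i, MeasurableSet (A i) := fun i =>
    measurableSet_le measurable_const (measurable_pi_apply i)
  let B : Set (ι → ℝ) := {x | t ≤ f x}
  have hB : MeasurableSet B := measurableSet_le measurable_const hf
  let Z : (ι → ℝ) → ℝ := fun x => ∑ i ∈ J, (A i).indicator 1 x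
  let v : (ι → ℝ) → ℝ := B.indicator 1
  have i1 : ∀ S : Set (ι → ℝ), MeasurableSet S → PG (S.indicator (1 : (ι → ℝ) → ℝ)) := fun S hS =>
    PG.of_bdd (measurable_one.indicator hS) (A := 1) fun z => by
      by_cases h : z ∈ S <;> simp [h]
  have hZ : PG Z := PG.sum _ fun i _ => i1 _ (hA i)
  have hvP : PG v := i1 _ hB
  have hcs := integral_cs γ (hZ.sq.integrable γ) (hvP.sq.integrable γ) ((hZ.mul hvP).integrable γ)
  have eZv : ∀ x, Z x * v x = Z x := by
    intro x
    by_cases h : x ∈ B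
    · simp [v, h]
    · have : Z x = 0 := Finset.sum_eq_zero fun i _ => by
        have : x ∉ A i := fun h' => h (le_trans (show t ≤ x i from h') (hfx i x))
        simp [this]
      simp [this]
  have ev : ∀ x, v x ^ 2 = v x := by
    intro x
    by_cases h : x ∈ B <;> simp [v, h]
  have eZ : ∀ x, Z x ^ 2 = ∑ i ∈ J, ∑ j ∈ J, (A i ∩ A j).indicator (1 : (ι → ℝ) → ℝ) x := by
    intro x
    rw [sq, Finset.sum_mul_sum]
    refine Finset.sum_congr rfl fun i _ => Finset.sum_congr rfl fun j _ => ?_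
    rw [Set.inter_indicator_one]; rfl
  simp only [eZv, ev, eZ] at hcs
  have hiZ : ∫ x, Z x ∂γ = ∑ i ∈ J, γ.real (A i) := by
    simp only [Z]
    rw [integral_finsetSum _ fun i _ => (i1 _ (hA i)).integrable γ]
    exact Finset.sum_congr rfl fun i _ => integral_indicator_one (hA i)
  have hiv : ∫ x, v x ∂γ = γ.real B := integral_indicator_one hB
  have hiZ2 : ∫ x, ∑ i ∈ J, ∑ j ∈ J, (A i ∩ A j).indicator (1 : (ι → ℝ) → ℝ) x ∂γ =
      ∑ i ∈ J, ∑ j ∈ J, γ.real (A i ∩ A j) := by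
    rw [integral_finsetSum _ fun i _ => (PG.sum J fun j _ => i1 _ ((hA i).inter (hA j))).integrable γ]
    refine Finset.sum_congr rfl fun i _ => ?_
    rw [integral_finsetSum _ fun j _ => (i1 _ ((hA i).inter (hA j))).integrable γ]
    exact Finset.sum_congr rfl fun j _ => integral_indicator_one ((hA i).inter (hA j))
  rw [hiZ, hiv, hiZ2] at hcs
  set E := exp (-t ^ 2 / (1 + δ))
  set Q := ∑ i ∈ J, γ.real (A i)
  set n' : ℝ := (J.card : ℝ)
  have hn' : 0 < n' := by simpa [n'] using hJ0
  set q := exp (-(t+1) ^ 2 / 2) / 3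
  have hq : 0 < q := by positivity
  have hE : 0 < E := exp_pos _
  have hS : ∑ i ∈ J, ∑ j ∈ J, γ.real (A i ∩ A j) ≤ Q + n' ^ 2 * E := by
    have : ∀ i ∈ J, ∑ j ∈ J, γ.real (A i ∩ A j) ≤ γ.real (A i) + n' * E := by
      intro i hi
      calc _ ≤ ∑ j ∈ J, ((if j = i then γ.real (A i) else 0) + E) := by
            refine Finset.sum_le_sum fun j hj => ?_
            by_cases h : j = i
            · simp only [h, Set.inter_self, if_true]; linarith
            · simp only [h, if_false, zero_add]
              exact pair_tail γ hγ (hv i) (hv j) hδ ht (hJ i hi j hj (Ne.symm h))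
        _ = _ := by
            rw [Finset.sum_add_distrib, Finset.sum_ite_eq' J i, if_pos hi]
            simp [n']
    refine (Finset.sum_le_sum this).trans (le_of_eq ?_)
    rw [Finset.sum_add_distrib]
    simp [n', Q]; ring
  have hQ : n' * q ≤ Q := by
    have := Finset.sum_le_sum fun i (_ : i ∈ J) => coord_lower γ hγ i ht (hv i)
    simpa [n', Q, q] using this
  have hp : 0 ≤ γ.real B := measureReal_nonneg
  have h1 : Q ^ 2 ≤ (Q + n' ^ 2 * E) * γ.real B :=
    hcs.trans (mul_le_mul_of_nonneg_right hS hp)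
  have ha : 0 < n' * q := by positivity
  have hc : 0 < n' ^ 2 * E := by positivity
  have h2 : (n' * q) ^ 2 * (Q + n' ^ 2 * E) ≤ Q ^ 2 * (n' * q + n' ^ 2 * E) := by
    have := mul_nonneg (mul_nonneg ha.le (ha.le.trans hQ)) (sub_nonneg.2 hQ)
    have h3 : (n' * q) ^ 2 ≤ Q ^ 2 := pow_le_pow_left₀ ha.le hQ 2
    nlinarith [mul_le_mul_of_nonneg_right h3 hc.le]
  have h3 : (n' * q) ^ 2 * (Q + n' ^ 2 * E) ≤
      ((n' * q + n' ^ 2 * E) * γ.real B) * (Q + n' ^ 2 * E) := by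
    refine h2.trans ?_
    calc _ ≤ ((Q + n' ^ 2 * E) * γ.real B) * (n' * q + n' ^ 2 * E) := by gcongr
      _ = _ := by ring
  have h4 := le_of_mul_le_mul_right h3 (by linarith)
  have h5 : n' * (n' * q ^ 2) ≤ n' * ((q + n' * E) * γ.real B) := by
    calc _ = (n' * q) ^ 2 := by ring
      _ ≤ _ := h4
      _ = _ := by ring
  exact le_of_mul_le_mul_left h5 hn'

include hγ in
lemma lower_prob {f : (ι → ℝ) → ℝ} (hf : Measurable f) (hfx : ∀ i x, x i ≤ f x)
    (hv : ∀ i, ∫ x, x i ^ 2 ∂γ = 1) (J : Finset ι)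
    (hJ : ∀ i ∈ J, ∀ j ∈ J, i ≠ j → ∫ x, x i * x j ∂γ ≤ 1/400) {L l : ℝ}
    (hL : 1 ≤ L) (hJc : exp (l ^ 2) ≤ 2 * L * J.card) (hl : 400 ≤ l) (hlL : log (12 * L) ≤ l) :
    exp (-(l ^ 2 / 100)) ≤ γ.real {x | l ≤ f x} := by
  have hJ0 : 0 < J.card := by
    rcases Nat.eq_zero_or_pos J.card with h | h
    · rw [h] at hJc; simp at hJc; linarith [exp_pos (l^2)]
    · exact h
  have h := second_moment γ hγ hf hfx hv J (δ := 1/400) (t := l) (by norm_num) (by linarith) hJ hJ0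
  have hn' : (0:ℝ) < J.card := by exact_mod_cast hJ0
  set n' : ℝ := (J.card : ℝ)
  set q := exp (-(l+1) ^ 2 / 2) / 3 with hq
  set E := exp (-l ^ 2 / (1 + 1/400)) with hE
  have hqp : 0 < q := by positivity
  have hEp : 0 < E := exp_pos _
  set r := exp (-(l ^ 2 / 100)) with hr
  have hrp : 0 < r := exp_pos _
  have hr1 : r ≤ 1 := exp_le_one_iff.2 (by have := sq_nonneg l; linarith)
  have c1 : 2 * r * q ≤ n' * q ^ 2 := by
    have a1 : 12 * L * exp (l + 1/2) ≤ exp (l ^ 2 / 2) := by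
      rw [← Real.exp_log (show 0 < 12 * L by linarith), ← exp_add]
      apply exp_le_exp.2
      nlinarith
    have a2 : exp (l ^ 2) * q = exp (l ^ 2 / 2) / exp (l + 1/2) / 3 := by
      rw [hq, ← exp_sub, ← mul_div_assoc, ← exp_add]
      congr 2; ring
    have a3 : 12 * L ≤ exp (l ^ 2 / 2) / exp (l + 1/2) := by
      rwa [le_div_iff₀ (exp_pos _)]
    have a4 : 4 * L ≤ exp (l ^ 2) * q := by rw [a2]; linarith
    have a5 : 4 * L ≤ 2 * L * n' * q := a4.trans (by gcongr)
    have a6 : 2 ≤ n' * q := by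
      have : L * 2 ≤ L * (n' * q) := by nlinarith
      exact le_of_mul_le_mul_left this (by linarith)
    nlinarith
  have c2 : 2 * r * E ≤ q ^ 2 := by
    have a1 : q ^ 2 = exp (-(l+1)^2) / 9 := by
      rw [hq, div_pow, ← exp_nat_mul]; congr 2
      · push_cast; ring
      · norm_num
    have a2 : E ≤ exp (-(l ^ 2 * (399/400))) := by
      rw [hE]
      apply exp_le_exp.2
      rw [div_le_iff₀ (by norm_num)]
      nlinarith [sq_nonneg l]
    rw [a1, le_div_iff₀ (by norm_num)]
    have a3 : (18:ℝ) ≤ exp 18 := by linarith [add_one_le_exp (18:ℝ)]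
    calc 2 * r * E * 9 = 18 * (r * E) := by ring
      _ ≤ exp 18 * (exp (-(l ^ 2 / 100)) * exp (-(l ^ 2 * (399/400)))) := by gcongr
      _ = exp (18 + (-(l ^ 2 / 100) + -(l ^ 2 * (399/400)))) := by rw [exp_add, exp_add]
      _ ≤ _ := by
        apply exp_le_exp.2
        nlinarith
  have c3 : (q + n' * E) * r ≤ n' * q ^ 2 := by
    nlinarith [mul_le_mul_of_nonneg_left c2 hn'.le]
  exact le_of_mul_le_mul_left (c3.trans h) (by positivity)

include hγ in
lemma lower_tail {f : (ι → ℝ) → ℝ} {p : ι → (ι → ℝ) → ℝ} (hf : Measurable f)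
    (hpc : ∀ i, Continuous (p i)) (hp0 : ∀ i x, 0 ≤ p i x)
    (hp1 : ∀ x, ∑ i, p i x = 1) (hS : SG f p 1) (hv : ∀ i j, ∫ x, x i * x j ∂γ ≤ 1)
    {l : ℝ} (hl : 0 ≤ l) (hc : (Fintype.card ι : ℝ) = exp (l ^ 2))
    (hlow : exp (-(l ^ 2 / 100)) ≤ γ.real {x | l ≤ f x}) :
    γ.real {x | f x < l / 2} ≤ 2 * exp (-(l ^ 2 / 50)) := by
  have h := conc γ hγ hf hpc hp0 hp1 hS hv (l := l / 5) (K := 100) (a := l ^ 2 / 50) (t := l)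
    (u := l / 2) (by linarith) (N := 100) (by norm_num) (by norm_num)
  have e0 : l - l / 2 = l / 2 := by ring
  have hpi := Real.pi_pos
  have hpi2 : π < 3.1416 := Real.pi_lt_d4
  set s := sin (π / (2 * ((100:ℕ):ℝ))) with hs
  set c := cos (π / (2 * ((100:ℕ):ℝ))) with hcc
  have hs1 : s ≤ π / 200 := by
    have := Real.sin_le (show 0 ≤ π / (2 * ((100:ℕ):ℝ)) by positivity)
    refine this.trans (le_of_eq ?_); norm_num
  have hs0 : 0 ≤ s := Real.sin_nonneg_of_nonneg_of_le_pi (by positivity) (by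
    rw [div_le_iff₀ (by positivity)]; push_cast; nlinarith)
  have hc1 : 1 - c ≤ 1 / 8000 := by
    have := Real.one_sub_sq_div_two_le_cos (x := π / (2 * ((100:ℕ):ℝ)))
    have h2 : (π / (2 * ((100:ℕ):ℝ))) ^ 2 / 2 ≤ 1 / 8000 := by
      push_cast
      nlinarith
    linarith
  have hc0 : 0 ≤ 1 - c := by linarith [Real.cos_le_one (π / (2 * ((100:ℕ):ℝ)))]
  have b1 : (l / 5 * ((100:ℕ):ℝ) * s) ^ 2 / 2 ≤ l ^ 2 / 20 := by
    have : s ^ 2 ≤ (π / 200) ^ 2 := pow_le_pow_left₀ hs0 hs1 2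
    have h3 : s ^ 2 ≤ 1 / 4000 * (1000 / 1000) := by nlinarith
    push_cast
    nlinarith [mul_le_mul_of_nonneg_left h3 (sq_nonneg l)]
  have b2 : (100 * (l / 5 * ((100:ℕ):ℝ) * (1 - c))) ^ 2 / 2 - (100 - 1) * (l ^ 2 / 50) + l ^ 2
      ≤ l ^ 2 / 50 := by
    have h3 : (1 - c) ^ 2 ≤ (1 / 8000) ^ 2 := pow_le_pow_left₀ hc0 hc1 2
    push_cast
    nlinarith [mul_le_mul_of_nonneg_left h3 (sq_nonneg l), sq_nonneg l]
  have b3 : exp (l ^ 2 / 50) + Fintype.card ι * exp ((100 * (l / 5 * ((100:ℕ):ℝ) * (1 - c))) ^ 2 / 2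
      - (100 - 1) * (l ^ 2 / 50)) ≤ 2 * exp (l ^ 2 / 50) := by
    rw [hc, ← exp_add, two_mul]
    gcongr
    linarith
  have h2 : γ.real {x | l ≤ f x} * γ.real {x | f x < l / 2} ≤ 2 * exp (-(3 * l ^ 2 / 100)) := by
    rw [e0] at h
    refine h.trans ?_
    calc _ ≤ exp (-(l / 5 * (l / 2))) * exp (l ^ 2 / 20) * (2 * exp (l ^ 2 / 50)) := by gcongr
      _ = 2 * exp (-(l / 5 * (l / 2)) + l ^ 2 / 20 + l ^ 2 / 50) := by
        rw [exp_add, exp_add]; ring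
      _ = _ := by congr 2; ring
  have h3 : exp (-(l ^ 2 / 100)) * γ.real {x | f x < l / 2} ≤
      exp (-(l ^ 2 / 100)) * (2 * exp (-(l ^ 2 / 50))) := by
    calc _ ≤ γ.real {x | l ≤ f x} * γ.real {x | f x < l / 2} := by gcongr
      _ ≤ _ := h2
      _ = _ := by
        rw [mul_left_comm, ← exp_add]; congr 2; ring
  exact le_of_mul_le_mul_left h3 (exp_pos _)

include hγ in
theorem tail_main [Nonempty ι] (hv : ∀ i j, ∫ x, x i * x j ∂γ ≤ 1)
    (hv1 : ∀ i, ∫ x, x i ^ 2 ∂γ = 1) (J : Finset ι)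
    (hJ : ∀ i ∈ J, ∀ j ∈ J, i ≠ j → ∫ x, x i * x j ∂γ ≤ 1/400) {L l : ℝ}
    (hL : 1 ≤ L) (hc : (Fintype.card ι : ℝ) = exp (l ^ 2))
    (hJc : exp (l ^ 2) ≤ 2 * L * J.card) (hl : 400 ≤ l) (hlL : log (12 * L) ≤ l)
    (D : Finset ι) (hD : (D.card : ℝ) ≤ 2 * exp (l ^ 2 / 64)) :
    ∫ x, ∑ i ∈ D, gw (Fintype.card ι : ℝ) i x ∂γ ≤ exp (-(l ^ 2 / 200)) := by
  classical
  set β : ℝ := (Fintype.card ι : ℝ) with hβd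
  have hβ : 0 < β := by rw [hc]; exact exp_pos _
  have hfm : Measurable (sm β : (ι → ℝ) → ℝ) := (sm_cont β).measurable
  have hlt := lower_tail γ hγ hfm (gw_cont β) (gw_nonneg β) (gw_sum β) (sm_SG hβ) hv
    (by linarith) hc (lower_prob γ hγ hfm (fun i x => le_sm hβ i x) hv1 J hJ hL hJc hl hlL)
  let A : ι → Set (ι → ℝ) := fun i => {x | l / 4 ≤ x i}
  have hA : ∀ i, MeasurableSet (A i) := fun i =>
    measurableSet_le measurable_const (measurable_pi_apply i)
  let B : Set (ι → ℝ) := {x | sm β x < l / 2}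
  have hB : MeasurableSet B := measurableSet_lt hfm measurable_const
  have i1 : ∀ S : Set (ι → ℝ), MeasurableSet S → PG (S.indicator (1 : (ι → ℝ) → ℝ)) := fun S hS =>
    PG.of_bdd (measurable_one.indicator hS) (A := 1) fun z => by
      by_cases h : z ∈ S <;> simp [h]
  have pt : ∀ x, ∑ i ∈ D, gw β i x ≤
      B.indicator 1 x + ((∑ i ∈ D, (A i).indicator (1 : (ι → ℝ) → ℝ) x) + β * exp (-β)) := by
    intro x
    have n1 : ∀ i, 0 ≤ (A i).indicator (1 : (ι → ℝ) → ℝ) x := fun i =>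
      Set.indicator_nonneg (fun _ _ => zero_le_one) x
    have n2 : 0 ≤ ∑ i ∈ D, (A i).indicator (1 : (ι → ℝ) → ℝ) x := Finset.sum_nonneg fun i _ => n1 i
    have n3 : 0 ≤ β * exp (-β) := by positivity
    by_cases h : x ∈ B
    · rw [Set.indicator_of_mem h, Pi.one_apply]
      have : ∑ i ∈ D, gw β i x ≤ 1 := by
        rw [← gw_sum β x]
        exact Finset.sum_le_sum_of_subset_of_nonneg (Finset.subset_univ D)
          fun i _ _ => gw_nonneg β i x
      linarith
    · rw [Set.indicator_of_notMem h, zero_add]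
      have hx : l / 2 ≤ sm β x := not_lt.1 h
      have : ∀ i ∈ D, gw β i x ≤ (A i).indicator (1 : (ι → ℝ) → ℝ) x + exp (-β) := by
        intro i _
        by_cases h' : x ∈ A i
        · rw [Set.indicator_of_mem h', Pi.one_apply]
          linarith [gw_le_one β i x, exp_pos (-β)]
        · rw [Set.indicator_of_notMem h', zero_add, gw_eq hβ]
          apply exp_le_exp.2
          have : x i < l / 4 := not_le.1 h'
          nlinarith
      refine (Finset.sum_le_sum this).trans ?_
      rw [Finset.sum_add_distrib]
      gcongr
      rw [Finset.sum_const, nsmul_eq_mul]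
      gcongr
      rw [hβd]
      exact_mod_cast Finset.card_le_univ D
  have pgS : PG (fun x => (∑ i ∈ D, (A i).indicator (1 : (ι → ℝ) → ℝ) x) + β * exp (-β)) :=
    (PG.sum _ fun i _ => i1 _ (hA i)).add (PG.const _)
  have pgG : PG (fun x => ∑ i ∈ D, gw β i x) := PG.sum _ fun i _ =>
    PG.of_bdd (gw_cont β i).measurable (A := 1) fun z => by
      rw [abs_of_nonneg (gw_nonneg β i z)]; exact gw_le_one β i z
  refine (integral_mono (pgG.integrable γ) (((i1 _ hB).add pgS).integrable γ) pt).trans ?_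
  rw [integral_add ((i1 _ hB).integrable γ) (pgS.integrable γ),
    integral_add ((PG.sum _ fun i _ => i1 _ (hA i)).integrable γ) (integrable_const _),
    integral_finsetSum _ (fun i _ => (i1 _ (hA i)).integrable γ), integral_indicator_one hB]
  have hAi : ∀ i ∈ D, ∫ x, (A i).indicator (1 : (ι → ℝ) → ℝ) x ∂γ ≤ exp (-(l ^ 2 / 32)) := by
    intro i _
    rw [integral_indicator_one (hA i)]
    refine (coord_tail γ hγ i (by linarith) (hv1 i).le).trans (le_of_eq ?_)
    congr 1; ring
  have hs := Finset.sum_le_sum hAi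
  rw [Finset.sum_const, nsmul_eq_mul] at hs
  have k1 : (D.card : ℝ) * exp (-(l ^ 2 / 32)) ≤ 2 * exp (-(l ^ 2 / 64)) := by
    calc _ ≤ 2 * exp (l ^ 2 / 64) * exp (-(l ^ 2 / 32)) := by gcongr
      _ = 2 * exp (-(l ^ 2 / 64)) := by
        rw [mul_assoc, ← exp_add]; congr 2; ring
  have k2 : γ.real B ≤ 2 * exp (-(l ^ 2 / 64)) := hlt.trans (by
    gcongr ?_ * exp (-?_)
    linarith [sq_nonneg l])
  have k3 : β * exp (-β) ≤ exp (-(l ^ 2 / 64)) := by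
    have : l ^ 2 * 2 ≤ β := by
      rw [hc]
      have := Real.quadratic_le_exp_of_nonneg (sq_nonneg l)
      nlinarith
    calc β * exp (-β) = exp (l ^ 2 + -β) := by rw [exp_add, ← hc]
      _ ≤ _ := by
        apply exp_le_exp.2
        nlinarith [sq_nonneg l]
  have k4 : 5 * exp (-(l ^ 2 / 64)) ≤ exp (-(l ^ 2 / 200)) := by
    have : (5:ℝ) ≤ exp 5 := by linarith [add_one_le_exp (5:ℝ)]
    calc _ ≤ exp 5 * exp (-(l ^ 2 / 64)) := by gcongr
      _ = exp (5 + -(l ^ 2 / 64)) := by rw [exp_add]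
      _ ≤ _ := by
        apply exp_le_exp.2
        nlinarith
  simp only [integral_const, probReal_univ, one_smul]
  linarith

end Tail

open MeasureTheory ProbabilityTheory Real

section Fin
variable {Ω : Type*} [MeasurableSpace Ω] {P : Measure Ω} [IsProbabilityMeasure P]
    {X : ℕ → Ω → ℝ} (hXmeas : ∀ i, Measurable (X i))
    (hgauss : ∀ (k : ℕ) (s : Fin k → ℕ) (a : Fin k → ℝ), ∃ v : NNReal,
      P.map (fun ω => ∑ i, a i * X (s i) ω) = gaussianReal 0 v)
    {φ : ℕ → ℝ} (hφ0 : φ 0 = 1)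
    (hcov : ∀ i j, ∫ ω, X i ω * X j ω ∂P = φ (max i j - min i j))
    (hφmono : Antitone φ)

/-- the law of the finite subfamily -/
noncomputable def gam (P : Measure Ω) (X : ℕ → Ω → ℝ) (n : ℕ) : Measure (Set.Icc 1 n → ℝ) :=
  P.map (fun ω i => X i ω)

include hXmeas hgauss in
lemma gam_law (n : ℕ) (L : (Set.Icc 1 n → ℝ) →L[ℝ] ℝ) :
    ∃ v : NNReal, (gam P X n).map L = gaussianReal 0 v := by
  let e := Fintype.equivFin (Set.Icc 1 n)
  obtain ⟨v, hv⟩ := hgauss _ (fun j => (e.symm j : ℕ)) (fun j => L (Pi.single (e.symm j) 1))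
  refine ⟨v, ?_⟩
  rw [← hv, gam, Measure.map_map (by fun_prop) (by fun_prop)]
  congr 1
  ext ω
  have h1 : (fun i : Set.Icc 1 n => X i ω) =
      ∑ i : Set.Icc 1 n, (X i ω) • (Pi.single i (1:ℝ) : Set.Icc 1 n → ℝ) := by
    ext j; simp [Finset.sum_apply, Pi.single_apply]
  simp only [Function.comp]
  rw [h1, map_sum, ← Equiv.sum_comp e.symm]
  exact Finset.sum_congr rfl fun j _ => by simp [mul_comm]

include hXmeas hgauss in
lemma gam_gauss (n : ℕ) : IsGaussian (gam P X n) :=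
  isGaussian_of_map_eq_gaussianReal fun L => ⟨0, gam_law hXmeas hgauss n L⟩

include hXmeas hgauss in
lemma gam_zero (n : ℕ) : ∫ x, x ∂(gam P X n) = 0 := by
  have := gam_gauss hXmeas hgauss n
  ext i
  let L := ContinuousLinearMap.proj (R := ℝ) (φ := fun _ : Set.Icc 1 n => ℝ) i
  obtain ⟨v, hv⟩ := gam_law hXmeas hgauss n L
  have h1 := IsGaussian.integral_dual (μ := gam P X n) L
  have h2 : ∫ y, y ∂((gam P X n).map L) = ∫ x, L x ∂(gam P X n) :=
    integral_map (by fun_prop) (by fun_prop)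
  rw [hv, integral_id_gaussianReal] at h2
  rw [← h2] at h1
  exact h1.symm

include hXmeas hcov in
lemma gam_cov (n : ℕ) (i j : Set.Icc 1 n) :
    ∫ x, x i * x j ∂(gam P X n) = φ (max (i:ℕ) j - min (i:ℕ) j) := by
  rw [gam, integral_map (by fun_prop) (by fun_prop)]
  exact hcov i j

include hXmeas in
lemma gam_var (n : ℕ) (hn : 1 ≤ n) : variance (fun ω => ⨆ i : Set.Icc 1 n, X i ω) P =
    variance mx (gam P X n) := by
  have : Nonempty (Set.Icc 1 n) := ⟨⟨1, by simp [hn]⟩⟩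
  rw [gam, variance_map mx_PG.1.aemeasurable (by fun_prop)]
  rfl

lemma log_div_sq {n : ℝ} (hn : 1 < n) : (log n / n) ^ 2 ≤ 1 / log n := by
  have hy : 0 < log n := Real.log_pos hn
  have h := Real.pow_div_factorial_le_exp (2 * log n) (by positivity) 3
  have e : exp (2 * log n) = n ^ 2 := by
    rw [mul_comm, Real.exp_mul, Real.exp_log (by linarith)]; norm_num
  rw [e] at h
  norm_num [Nat.factorial] at h
  rw [div_pow, div_le_div_iff₀ (by positivity) hy]
  nlinarith [pow_pos hy 3]

include hXmeas hgauss hφ0 hcov hφmono in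
lemma var_le_12 (n : ℕ) (hn : 2 ≤ n) :
    variance (fun ω => ⨆ i : Set.Icc 1 n, X i ω) P ≤ 12 := by
  have : Nonempty (Set.Icc 1 n) := ⟨⟨1, by simp; omega⟩⟩
  have := gam_gauss hXmeas hgauss n
  have hn' : (2:ℝ) ≤ n := by exact_mod_cast hn
  rw [gam_var hXmeas n (by omega)]
  have hβ : (0:ℝ) < n := by linarith
  refine (var_mx_le (gam P X n) hβ).trans ?_
  have h := thmA (gam P X n) (gam_zero hXmeas hgauss n) (κ := Fin 0) (sm_PG hβ) (gw_cont (n:ℝ))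
    (gw_nonneg _) (gw_sum _) (sm_SG hβ) (fun _ => ∅) (ε := 1) (Λ := 64) (by norm_num)
    (fun i j => by
      rw [gam_cov hXmeas hcov]
      simpa [hφ0] using hφmono (Nat.zero_le _)) (by simp) (by norm_num) (fun a => a.elim0)
  have hl : log n / n ≤ 1 := by
    rw [div_le_one hβ]; linarith [Real.log_le_sub_one_of_pos hβ]
  have hl0 : 0 ≤ log n / n := div_nonneg (Real.log_nonneg (by linarith)) hβ.le
  have hcard : (Fintype.card (Set.Icc 1 n) : ℝ) = n := by simp
  rw [hcard]
  nlinarith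

include hXmeas hgauss hφ0 hcov hφmono in
lemma var_big {K : ℕ} (hK : 1 ≤ K) (hφK : φ K ≤ 1 / 400) (n : ℕ) (hn : 2 ≤ n)
    (hl : 400 ≤ √(log n)) (hlK : log (12 * K) ≤ √(log n)) :
    variance (fun ω => ⨆ i : Set.Icc 1 n, X i ω) P ≤
      8 * max (φ ⌊(n : ℝ) ^ (1/64 : ℝ)⌋₊) 0 + 25602 * (1 / log n) := by
  have hne : Nonempty (Set.Icc 1 n) := ⟨⟨1, by simp; omega⟩⟩
  have := gam_gauss hXmeas hgauss n
  have hn' : (2:ℝ) ≤ n := by exact_mod_cast hn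
  have hlog : 0 < log n := Real.log_pos (by linarith)
  have hβ : (0:ℝ) < n := by linarith
  have hcard : (Fintype.card (Set.Icc 1 n) : ℝ) = n := by simp
  set l := √(log n) with hld
  have hl2 : l ^ 2 = log n := Real.sq_sqrt hlog.le
  have hexp : exp (l ^ 2) = n := by rw [hl2, Real.exp_log hβ]
  have hK' : (1:ℝ) ≤ K := by exact_mod_cast hK
  have hnK : 12 * (K:ℝ) ≤ n := by
    rw [← hexp, ← Real.log_le_iff_le_exp (by linarith)]
    nlinarith
  have hnK' : K ≤ n := by
    have : (K:ℝ) ≤ n := by linarith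
    exact_mod_cast this
  set m := ⌊(n : ℝ) ^ (1/64 : ℝ)⌋₊ with hm
  have hm1 : 1 ≤ m := by
    rw [hm, Nat.one_le_floor_iff]
    exact Real.one_le_rpow (by linarith) (by norm_num)
  have hme : (m:ℝ) ≤ exp (l ^ 2 / 64) := by
    refine (Nat.floor_le (by positivity)).trans (le_of_eq ?_)
    rw [Real.rpow_def_of_pos hβ, hl2]; congr 1; ring
  have hcle : ∀ i j, ∫ x, x i * x j ∂(gam P X n) ≤ 1 := fun i j => by
    rw [gam_cov hXmeas hcov, ← hφ0]; exact hφmono (Nat.zero_le _)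
  have hc1 : ∀ i, ∫ x, x i ^ 2 ∂(gam P X n) = 1 := fun i => by
    simp only [sq]
    rw [gam_cov hXmeas hcov, ← hφ0]; simp
  classical
  let J : Finset (Set.Icc 1 n) := Finset.univ.filter fun i => K ∣ (i:ℕ)
  have hJ : ∀ i ∈ J, ∀ j ∈ J, i ≠ j → ∫ x, x i * x j ∂(gam P X n) ≤ 1/400 := by
    intro i hi j hj hij
    rw [gam_cov hXmeas hcov]
    refine le_trans (hφmono ?_) hφK
    have hi' : K ∣ (i:ℕ) := (Finset.mem_filter.1 hi).2
    have hj' : K ∣ (j:ℕ) := (Finset.mem_filter.1 hj).2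
    have hij' : (i:ℕ) ≠ j := fun h => hij (Subtype.ext h)
    apply Nat.le_of_dvd (by omega)
    apply Nat.dvd_sub
    · rcases max_choice (i:ℕ) j with h | h <;> rw [h] <;> assumption
    · rcases min_choice (i:ℕ) j with h | h <;> rw [h] <;> assumption
  have hJc0 : n / K ≤ J.card := by
    have : (Finset.Icc 1 (n / K)).card ≤ J.card := by
      refine Finset.card_le_card_of_injOn (fun k => if h : k * K ∈ Set.Icc 1 n then ⟨k * K, h⟩
        else hne.some) ?_ ?_
      · intro k hk
        have hk' := Finset.mem_Icc.1 (Finset.mem_coe.1 hk)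
        have h : k * K ∈ Set.Icc 1 n := ⟨by nlinarith,
          (Nat.mul_le_mul_right K hk'.2).trans (Nat.div_mul_le_self n K)⟩
        simp [h, J]
      · intro k hk k' hk' he
        have h1 := Finset.mem_Icc.1 (Finset.mem_coe.1 hk)
        have h2 := Finset.mem_Icc.1 (Finset.mem_coe.1 hk')
        have h : k * K ∈ Set.Icc 1 n := ⟨by nlinarith,
          (Nat.mul_le_mul_right K h1.2).trans (Nat.div_mul_le_self n K)⟩
        have h' : k' * K ∈ Set.Icc 1 n := ⟨by nlinarith,
          (Nat.mul_le_mul_right K h2.2).trans (Nat.div_mul_le_self n K)⟩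
        simp only [h, h', dif_pos] at he
        have := congrArg Subtype.val he
        exact Nat.eq_of_mul_eq_mul_right (by omega) this
    simpa using this
  have hJc : exp (l ^ 2) ≤ 2 * K * J.card := by
    rw [hexp]
    have h1 : n < K * (n / K + 1) := Nat.lt_mul_div_succ n (by omega)
    have h2 : 1 ≤ n / K := (Nat.one_le_div_iff (by omega)).2 hnK'
    have h3 : n ≤ 2 * K * J.card := by
      calc n ≤ K * (n / K + 1) := h1.le
        _ ≤ K * (2 * J.card) := Nat.mul_le_mul_left K (by omega)
        _ = _ := by ring
    exact_mod_cast h3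
  let D : Fin (n+1) → Finset (Set.Icc 1 n) := fun a =>
    Finset.univ.filter fun i => (i:ℕ) / m = a ∨ (i:ℕ) / m = a + 1
  have hD : ∀ a, ((D a).card : ℝ) ≤ 2 * exp (l ^ 2 / 64) := by
    intro a
    have h1 : (D a).card ≤ (Finset.Ico ((a:ℕ) * m) (a * m + 2 * m)).card := by
      refine Finset.card_le_card_of_injOn (fun i => (i:ℕ)) ?_ (Subtype.val_injective.injOn)
      intro i hi
      have hi' := (Finset.mem_filter.1 (Finset.mem_coe.1 hi)).2
      have e1 := Nat.div_add_mod (i:ℕ) m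
      have e2 := Nat.mod_lt (i:ℕ) (show 0 < m by omega)
      simp only [Finset.coe_Ico, Set.mem_Ico]
      have e3 := Nat.zero_le ((i:ℕ) % m)
      rcases hi' with h | h <;> rw [h] at e1 <;> constructor <;> nlinarith
    have h2 : (D a).card ≤ 2 * m := by simpa using h1
    have h3 : ((D a).card : ℝ) ≤ 2 * m := by exact_mod_cast h2
    linarith
  have hA : ∀ a, ∫ x, ∑ i ∈ D a, gw (n:ℝ) i x ∂(gam P X n) ≤ exp (-(l ^ 2 / 200)) := by
    intro a
    have := tail_main (gam P X n) (gam_zero hXmeas hgauss n) hcle hc1 J hJ (L := K) (l := l) hK'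
      (by rw [hcard, hexp]) hJc hl hlK (D a) (hD a)
    rwa [hcard] at this
  have hmemD : ∀ i a, i ∈ D a ↔ ((i:ℕ) / m = a ∨ (i:ℕ) / m = a + 1) := fun i a => by simp [D]
  have hcnt : ∀ i, ∑ a, (if i ∈ D a then (1:ℝ) else 0) ≤ 2 := by
    intro i
    calc _ ≤ ∑ a : Fin (n+1), ((if (i:ℕ) / m = a then (1:ℝ) else 0) +
          (if (i:ℕ) / m = a + 1 then (1:ℝ) else 0)) := by
          refine Finset.sum_le_sum fun a _ => ?_
          simp only [hmemD]
          by_cases h1 : (i:ℕ) / m = a <;> by_cases h2 : (i:ℕ) / m = a + 1 <;> simp [h1, h2]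
      _ ≤ 1 + 1 := by
          rw [Finset.sum_add_distrib]
          refine add_le_add ?_ ?_
          · rw [Finset.sum_boole]
            have : (Finset.univ.filter fun a : Fin (n+1) => (i:ℕ) / m = a).card ≤ 1 :=
              Finset.card_le_one.2 fun a ha b hb => Fin.ext (by
                have := (Finset.mem_filter.1 ha).2
                have := (Finset.mem_filter.1 hb).2
                omega)
            exact_mod_cast this
          · rw [Finset.sum_boole]
            have : (Finset.univ.filter fun a : Fin (n+1) => (i:ℕ) / m = a + 1).card ≤ 1 :=
              Finset.card_le_one.2 fun a ha b hb => Fin.ext (by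
                have := (Finset.mem_filter.1 ha).2
                have := (Finset.mem_filter.1 hb).2
                omega)
            exact_mod_cast this
      _ = 2 := by norm_num
  have hcovD : ∀ i j, ∫ x, x i * x j ∂(gam P X n) ≤ max (φ m) 0 +
      ∑ a, (if i ∈ D a ∧ j ∈ D a then (1:ℝ) else 0) := by
    intro i j
    have hs0 : ∀ a, 0 ≤ (if i ∈ D a ∧ j ∈ D a then (1:ℝ) else 0) := fun a => by
      split_ifs <;> norm_num
    by_cases hd : max (i:ℕ) j - min (i:ℕ) j < m
    · have hε : 0 ≤ max (φ m) 0 := le_max_right _ _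
      have hmin : min (i:ℕ) j ≤ n := (min_le_left _ _).trans i.2.2
      have hlt : min (i:ℕ) j / m < n + 1 := by
        have := Nat.div_le_self (min (i:ℕ) j) m
        omega
      have key : ∀ k : ℕ, min (i:ℕ) j ≤ k → k - min (i:ℕ) j < m →
          k / m = min (i:ℕ) j / m ∨ k / m = min (i:ℕ) j / m + 1 := by
        intro k h1 h2
        have h3 : min (i:ℕ) j / m ≤ k / m := Nat.div_le_div_right h1
        have h4 : k / m ≤ (min (i:ℕ) j + m) / m := Nat.div_le_div_right (by omega)
        rw [Nat.add_div_right _ (by omega)] at h4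
        omega
      have hin : i ∈ D ⟨_, hlt⟩ ∧ j ∈ D ⟨_, hlt⟩ := by
        rw [hmemD, hmemD]
        exact ⟨key i (min_le_left _ _) (by omega), key j (min_le_right _ _) (by omega)⟩
      have h1 := Finset.single_le_sum
        (f := fun a => (if i ∈ D a ∧ j ∈ D a then (1:ℝ) else 0)) (fun a _ => hs0 a)
        (Finset.mem_univ (⟨_, hlt⟩ : Fin (n+1)))
      simp only [hin, and_self, if_true] at h1
      linarith [hcle i j]
    · have h1 : 0 ≤ ∑ a, (if i ∈ D a ∧ j ∈ D a then (1:ℝ) else 0) := Finset.sum_nonneg fun a _ => hs0 a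
      rw [gam_cov hXmeas hcov]
      have h2 : φ (max (i:ℕ) j - min (i:ℕ) j) ≤ φ m := hφmono (not_lt.1 hd)
      linarith [le_max_left (φ m) 0]
  have hmain := thmA (gam P X n) (gam_zero hXmeas hgauss n) (sm_PG hβ) (gw_cont (n:ℝ))
    (gw_nonneg _) (gw_sum _) (sm_SG hβ) D (ε := max (φ m) 0) (Λ := l ^ 2 / 200) (le_max_right _ _)
    hcovD hcnt (by rw [hl2]; positivity) hA
  rw [gam_var hXmeas n (by omega)]
  refine (var_mx_le (gam P X n) hβ).trans ?_
  have hls := log_div_sq (n := n) (by linarith)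
  rw [hcard]
  have e : 64 / (l ^ 2 / 200) = 12800 * (1 / log n) := by rw [hl2]; field_simp; norm_num
  rw [e] at hmain
  linarith

end Fin

theorem stationary_gaussian_sequence_variance_bound
    {Ω : Type*} [MeasurableSpace Ω] (P : Measure Ω) [IsProbabilityMeasure P]
    (X : ℕ → Ω → ℝ) (hXmeas : ∀ i, Measurable (X i))
    -- every finite subfamily is jointly centered Gaussian
    (hgauss : ∀ (k : ℕ) (s : Fin k → ℕ) (a : Fin k → ℝ), ∃ v : NNReal,
      P.map (fun ω => ∑ i, a i * X (s i) ω) = gaussianReal 0 v)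
    (φ : ℕ → ℝ) (hφ0 : φ 0 = 1)
    -- stationary covariance structure: `Cov(X_i, X_j) = φ(|i − j|)`
    (hcov : ∀ i j, ∫ ω, X i ω * X j ω ∂P = φ (max i j - min i j))
    (hφmono : Antitone φ) (hφ1 : φ 1 < 1 / 2) :
    ∃ α ∈ Set.Ioo (0 : ℝ) 1, ∃ C : ℝ, 0 < C ∧
      ∀ n : ℕ, 2 ≤ n →
        variance (fun ω => ⨆ i : Set.Icc 1 n, X i ω) P ≤
          C * max (φ ⌊(n : ℝ) ^ α⌋₊) (1 / Real.log n) := by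
  refine ⟨1/64, by norm_num, ?_⟩
  by_cases hK : ∃ K : ℕ, φ K ≤ 1 / 400
  · obtain ⟨K0, hK0⟩ := hK
    have hK : φ (K0 + 1) ≤ 1 / 400 := (hφmono (Nat.le_succ K0)).trans hK0
    have hlim : Filter.Tendsto (fun n : ℕ => √(log n)) Filter.atTop Filter.atTop :=
      Real.tendsto_sqrt_atTop.comp (Real.tendsto_log_atTop.comp tendsto_natCast_atTop_atTop)
    obtain ⟨n0, hn0⟩ := Filter.eventually_atTop.1 ((hlim.eventually_ge_atTop 400).and
      (hlim.eventually_ge_atTop (log (12 * (K0 + 1 : ℕ)))))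
    refine ⟨25610 + 12 * |log n0|, by positivity, fun n hn => ?_⟩
    have hn' : (2:ℝ) ≤ n := by exact_mod_cast hn
    have hlog : 0 < log n := Real.log_pos (by linarith)
    have hR1 : 1 / log n ≤ max (φ ⌊(n : ℝ) ^ (1/64:ℝ)⌋₊) (1 / Real.log n) := le_max_right _ _
    have hR2 : φ ⌊(n : ℝ) ^ (1/64:ℝ)⌋₊ ≤ max (φ ⌊(n : ℝ) ^ (1/64:ℝ)⌋₊) (1 / Real.log n) :=
      le_max_left _ _
    have hlp : 0 < 1 / log n := by positivity
    rcases le_total n0 n with h | h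
    · obtain ⟨h1, h2⟩ := hn0 n h
      refine (var_big hXmeas hgauss hφ0 hcov hφmono (K := K0 + 1) (by omega) hK n hn h1 h2).trans ?_
      have h3 : max (φ ⌊(n : ℝ) ^ (1/64:ℝ)⌋₊) 0 ≤
          max (φ ⌊(n : ℝ) ^ (1/64:ℝ)⌋₊) (1 / Real.log n) := max_le_max le_rfl hlp.le
      set R := max (φ ⌊(n : ℝ) ^ (1/64:ℝ)⌋₊) (1 / Real.log n)
      have := mul_nonneg (abs_nonneg (log n0)) (hlp.le.trans hR1)
      nlinarith
    · refine (var_le_12 hXmeas hgauss hφ0 hcov hφmono n hn).trans ?_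
      have h3 : log n ≤ |log n0| := (Real.log_le_log (by linarith) (by exact_mod_cast h)).trans
        (le_abs_self _)
      set R := max (φ ⌊(n : ℝ) ^ (1/64:ℝ)⌋₊) (1 / Real.log n)
      have h4 : 1 ≤ |log n0| * R := by
        calc 1 = log n * (1 / log n) := by field_simp
          _ ≤ |log n0| * R := by gcongr
      nlinarith [hlp.trans_le hR1]
  · push Not at hK
    refine ⟨4800, by norm_num, fun n hn => ?_⟩
    refine (var_le_12 hXmeas hgauss hφ0 hcov hφmono n hn).trans ?_
    have h1 := hK ⌊(n : ℝ) ^ (1/64:ℝ)⌋₊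
    have h2 := le_max_left (φ ⌊(n : ℝ) ^ (1/64:ℝ)⌋₊) (1 / Real.log n)
    linarith
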